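/- arXiv:1112.1266 — 9 statements merged into one kernel-verified Lean document; each statement's English description precedes it below -/
import Mathlib

section
/- Let β ∈ ℂ be transcendental over ℚ and let A ⊆ ℂ be any finite subset. Then the relation language L(β, A) is a regular language; that is, the semigroup generated by the affine maps x ↦ βx + t for t ∈ A is strongly automatic. -/
/-- Evaluation of a word `u₁ ⋯ uₙ` of digits as `∑ i, uᵢ β^(n - i)`. -/
def betaEval {k : Type*} [Field k] (β : k) (w : List k) : k :=
  w.foldl (fun acc a => β * acc + a) 0

/-- The relation language `L(β, A)` over the alphabet `A × A`: words
`(u₁,v₁) ⋯ (uₙ,vₙ)` such that `∑ uᵢ β^(n-i) = ∑ vᵢ β^(n-i)` in `k`, i.e. the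
corresponding compositions of the affine maps `x ↦ βx + t` agree. -/
def relLang {k : Type*} [Field k] (β : k) (A : Finset k) : Language (↥A × ↥A) :=
  { w | betaEval β (w.map fun p => (p.1 : k)) = betaEval β (w.map fun p => (p.2 : k)) }

open Polynomial

/-- Horner evaluation at `X` of a word whose letters carry polynomial weights. -/
noncomputable def hornerPoly {α R : Type*} [CommRing R] (c : α → R[X]) (w : List α) : R[X] :=
  w.foldl (fun p a => X * p + c a) 0

section HornerPoly

variable {α R : Type*} [CommRing R] (c : α → R[X])

theorem hornerPoly_concat (w : List α) (a : α) :
    hornerPoly c (w ++ [a]) = X * hornerPoly c w + c a := by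
  simp [hornerPoly]

theorem hornerPoly_append (x y : List α) :
    hornerPoly c (x ++ y) = X ^ y.length * hornerPoly c x + hornerPoly c y := by
  induction y using List.reverseRecOn with
  | nil => simp [hornerPoly]
  | append_singleton y a ih =>
    rw [← List.append_assoc, hornerPoly_concat, hornerPoly_concat, ih]
    simp only [List.length_append, List.length_singleton]
    ring

theorem coeff_hornerPoly_eq_zero {N : ℕ} (hN : ∀ a, ∀ k ≥ N, (c a).coeff k = 0)
    (w : List α) {k : ℕ} (hk : N + w.length ≤ k) : (hornerPoly c w).coeff k = 0 := by
  induction w using List.reverseRecOn generalizing k with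
  | nil => simp [hornerPoly]
  | append_singleton w a ih =>
    simp only [List.length_append, List.length_singleton] at hk
    obtain ⟨k, rfl⟩ : ∃ j, k = j + 1 := ⟨k - 1, by omega⟩
    rw [hornerPoly_concat, coeff_add, coeff_X_mul, ih (by omega), hN a _ (by omega), add_zero]

theorem finite_range_coeff_hornerPoly [Finite α] (k : ℕ) :
    (Set.range fun w : List α => (hornerPoly c w).coeff k).Finite := by
  induction k with
  | zero =>
    refine ((Set.finite_range fun a => (c a).coeff 0).insert 0).subset ?_
    rintro _ ⟨w, rfl⟩
    induction w using List.reverseRecOn with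
    | nil => simp [hornerPoly]
    | append_singleton w a _ => exact Or.inr ⟨a, by simp [hornerPoly_concat]⟩
  | succ k ih =>
    refine ((Set.Finite.image2 (· + ·) ih
      (Set.finite_range fun a => (c a).coeff (k + 1))).insert 0).subset ?_
    rintro _ ⟨w, rfl⟩
    induction w using List.reverseRecOn with
    | nil => simp [hornerPoly]
    | append_singleton w a _ =>
      exact Or.inr ⟨_, ⟨w, rfl⟩, _, ⟨a, rfl⟩, by simp [hornerPoly_concat]⟩

theorem finite_hornerPoly_of_append_eq_zero [Finite α] :
    {p : R[X] | ∃ x y : List α, hornerPoly c (x ++ y) = 0 ∧ hornerPoly c x = p}.Finite := by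
  obtain ⟨N, hN⟩ : ∃ N, ∀ a, ∀ k ≥ N, (c a).coeff k = 0 := by
    obtain ⟨B, hB⟩ := (Set.finite_range fun a => (c a).natDegree).bddAbove
    exact ⟨B + 1, fun a k hk =>
      coeff_eq_zero_of_natDegree_lt ((hB ⟨a, rfl⟩).trans_lt (by omega))⟩
  refine Set.Finite.of_finite_image (f := fun p (i : Fin N) => p.coeff i)
    ((Set.Finite.pi' fun i : Fin N => finite_range_coeff_hornerPoly c i).subset ?_) ?_
  · rintro _ ⟨_, ⟨x, y, -, rfl⟩, rfl⟩ i
    exact ⟨x, rfl⟩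
  · have high : ∀ x y : List α, hornerPoly c (x ++ y) = 0 →
        ∀ k ≥ N, (hornerPoly c x).coeff k = 0 := by
      intro x y h k hk
      rw [hornerPoly_append] at h
      have := congrArg (fun p => p.coeff (k + y.length)) h
      simpa [coeff_X_pow_mul, coeff_hornerPoly_eq_zero c hN y (k := k + y.length) (by omega)]
        using this
    rintro _ ⟨x, y, h, rfl⟩ _ ⟨x', y', h', rfl⟩ heq
    ext k
    by_cases hk : k < N
    · exact congrFun heq ⟨k, hk⟩
    · rw [high x y h k (by omega), high x' y' h' k (by omega)]

/-- The words whose Horner polynomials vanish, for finitely many systems of weights at once,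
form a regular language. -/
theorem isRegular_setOf_hornerPoly_eq_zero {ι : Type*} [Finite ι] [Finite α]
    (c : ι → α → R[X]) :
    Language.IsRegular ({w | ∀ i, hornerPoly (c i) w = 0} : Language α) := by
  set L : Language α := {w | ∀ i, hornerPoly (c i) w = 0}
  rw [Language.isRegular_iff_finite_range_leftQuotient]
  have hS := Set.Finite.pi' fun i => finite_hornerPoly_of_append_eq_zero (c i)
  let g : (ι → R[X]) → Language α :=
    fun r => {y | ∀ i, X ^ y.length * r i + hornerPoly (c i) y = 0}
  refine ((hS.image g).insert (0 : Language α)).subset ?_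
  rintro _ ⟨x, rfl⟩
  by_cases h : ∃ y, x ++ y ∈ L
  · obtain ⟨y, hy⟩ := h
    refine Or.inr ⟨fun i => hornerPoly (c i) x, fun i => ⟨x, y, hy i, rfl⟩, ?_⟩
    ext z
    change (∀ i, _ = _) ↔ ∀ i, hornerPoly (c i) (x ++ z) = 0
    simp only [hornerPoly_append]
  · left
    ext z
    exact ⟨fun hz => (h ⟨z, hz⟩).elim, fun hz => hz.elim⟩

end HornerPoly

/-- A finite family in an extension of `F` has polynomial coordinates with respect to some finite
family that is linearly independent over `F[β]`, when `β` is transcendental. -/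
theorem exists_polynomial_coordinates_of_transcendental {F K α : Type*} [Field F] [Field K]
    [Algebra F K] [Finite α] {β : K} (hβ : Transcendental F β) (d : α → K) :
    ∃ (n : ℕ) (b : Fin n → K) (c : Fin n → α → F[X]),
      (∀ a, d a = ∑ i, aeval β (c i a) * b i) ∧
      ∀ q : Fin n → F[X], ∑ i, aeval β (q i) * b i = 0 → ∀ i, q i = 0 := by
  let _ : Module F[X] K := Module.compHom K (aeval β : F[X] →ₐ[F] K).toRingHom
  have smul_def : ∀ (p : F[X]) (z : K), p • z = aeval β p * z := fun _ _ => rfl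
  have inj := transcendental_iff_injective.1 hβ
  have : Module.IsTorsionFree F[X] K := by
    refine Module.IsTorsionFree.of_smul_eq_zero fun p z h => ?_
    rw [smul_def, mul_eq_zero] at h
    exact h.imp_left ((map_eq_zero_iff _ inj).1 ·)
  let M := Submodule.span F[X] (Set.range d)
  have : Module.Finite F[X] M := Module.Finite.span_of_finite _ (Set.finite_range d)
  obtain ⟨n, b⟩ := Module.basisOfFiniteTypeTorsionFree' (R := F[X]) (M := M)
  refine ⟨n, fun i => b i, fun i a => b.repr ⟨d a, Submodule.subset_span ⟨a, rfl⟩⟩ i, ?_, ?_⟩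
  · intro a
    have := congrArg Subtype.val (b.sum_repr ⟨d a, Submodule.subset_span ⟨a, rfl⟩⟩)
    rw [Submodule.coe_sum] at this
    exact this.symm
  · intro q hq
    refine Fintype.linearIndependent_iff.1 b.linearIndependent q (Subtype.ext ?_)
    simpa [smul_def] using hq

theorem betaEval_concat {k : Type*} [Field k] (β : k) (w : List k) (a : k) :
    betaEval β (w ++ [a]) = β * betaEval β w + a := by
  simp [betaEval]

/-- If `β ∈ ℂ` is transcendental over `ℚ`, then for every finite `A ⊆ ℂ` the relation
language `L(β, A)` is regular: the semigroup generated by the maps `x ↦ βx + t`, `t ∈ A`,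
is strongly automatic. -/
theorem relLang_isRegular_of_transcendental (β : ℂ) (hβ : Transcendental ℚ β)
    (A : Finset ℂ) : (relLang β A).IsRegular := by
  obtain ⟨n, b, c, hd, hb⟩ :=
    exists_polynomial_coordinates_of_transcendental hβ fun p : ↥A × ↥A => (p.1 : ℂ) - p.2
  have key : ∀ w : List (↥A × ↥A),
      betaEval β (w.map fun p => (p.1 : ℂ)) - betaEval β (w.map fun p => (p.2 : ℂ)) =
        ∑ i, aeval β (hornerPoly (c i) w) * b i := by
    intro w
    induction w using List.reverseRecOn with
    | nil => simp [hornerPoly, betaEval]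
    | append_singleton w a ih =>
      simp only [List.map_append, List.map_singleton, betaEval_concat, hornerPoly_concat,
        map_add, map_mul, aeval_X, add_mul, Finset.sum_add_distrib, mul_assoc]
      rw [← Finset.mul_sum, ← ih, ← hd a]
      ring
  suffices h : relLang β A = {w | ∀ i, hornerPoly (c i) w = 0} from
    h ▸ isRegular_setOf_hornerPoly_eq_zero c
  ext w
  change _ = _ ↔ ∀ i, _ = _
  rw [← sub_eq_zero, key]
  exact ⟨hb _, fun h => by simp [h]⟩
end

section
/- Let k be a field of positive characteristic, let β ∈ k be nonzero, and let A ⊆ k be any finite subset. Then the relation language L(β, A) is a regular language; that is, the semigroup generated by the affine maps x ↦ βx + t for t ∈ A is strongly automatic. -/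
/-- The space `∑ i < n, β ^ i • W` of values of words of length `n` with digits in `W`. -/
def digitSpan {R k : Type*} [CommRing R] [Field k] [Algebra R k] (β : k) (W : Submodule R k) :
    ℕ → Submodule R k
  | 0 => ⊥
  | n + 1 => digitSpan β W n ⊔ W.map (LinearMap.mulLeft R (β ^ n))

section digitSpan

variable {R k : Type*} [CommRing R] [Field k] [Algebra R k] {β : k} {W : Submodule R k}

theorem mem_digitSpan_succ {n : ℕ} {x : k} :
    x ∈ digitSpan β W (n + 1) ↔ ∃ u ∈ digitSpan β W n, ∃ w ∈ W, u + β ^ n * w = x := by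
  simp [digitSpan, Submodule.mem_sup]

theorem digitSpan_mono : Monotone (digitSpan β W) :=
  monotone_nat_of_le_succ fun _ => le_sup_left

theorem digitSpan_fg (hW : W.FG) (n : ℕ) : (digitSpan β W n).FG := by
  induction n with
  | zero => exact Submodule.fg_bot
  | succ n ih => exact ih.sup (hW.map _)

theorem mul_mem_digitSpan {n : ℕ} {x : k} (hx : x ∈ digitSpan β W n) :
    β * x ∈ digitSpan β W (n + 1) := by
  induction n generalizing x with
  | zero =>
    obtain rfl : x = 0 := by simpa [digitSpan] using hx
    simp
  | succ n ih =>
    obtain ⟨u, hu, w, hw, rfl⟩ := mem_digitSpan_succ.1 hx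
    exact mem_digitSpan_succ.2 ⟨β * u, ih hu, w, hw, by ring⟩

theorem pow_mul_mem_digitSpan {n : ℕ} {x : k} (hx : x ∈ digitSpan β W n) (m : ℕ) :
    β ^ m * x ∈ digitSpan β W (n + m) := by
  induction m with
  | zero => simpa using hx
  | succ m ih =>
    rw [pow_succ', mul_assoc]
    exact mul_mem_digitSpan ih

theorem exists_pow_mul_mem_digitSpan_of_finite (hW : (W : Set k).Finite) :
    ∃ N, ∀ w ∈ W, ∀ n, β ^ n * w ∈ digitSpan β W n → β ^ N * w ∈ digitSpan β W N := by
  have h_each (w : k) :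
      ∃ N, ∀ n, β ^ n * w ∈ digitSpan β W n → β ^ N * w ∈ digitSpan β W N := by
    by_cases h : ∃ n, β ^ n * w ∈ digitSpan β W n
    · exact h.imp fun _ hN _ _ => hN
    · exact ⟨0, fun n hn => (h ⟨n, hn⟩).elim⟩
  choose f hf using h_each
  refine ⟨hW.toFinset.sup f, fun w hw n hn => ?_⟩
  obtain ⟨m, hm⟩ := Nat.exists_eq_add_of_le (Finset.le_sup (f := f) (hW.mem_toFinset.2 hw))
  rw [hm, add_comm, pow_add, mul_assoc, add_comm]
  exact pow_mul_mem_digitSpan (hf w n hn) m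

/-- Over a finite digit space, the values of words which can be completed to a word of value
zero lie in a fixed `digitSpan`. -/
theorem exists_mem_digitSpan_of_pow_mul_mem (hW : (W : Set k).Finite) :
    ∃ N, ∀ a m, ∀ s ∈ digitSpan β W a, β ^ m * s ∈ digitSpan β W m → s ∈ digitSpan β W N := by
  obtain ⟨N, hN⟩ := exists_pow_mul_mem_digitSpan_of_finite (β := β) hW
  refine ⟨N, fun a m s hs hm => ?_⟩
  induction a with
  | zero => exact digitSpan_mono N.zero_le hs
  | succ a ih =>
    rcases Nat.lt_or_ge a N with h_lt | h_ge
    · exact digitSpan_mono h_lt hs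
    obtain ⟨u, hu, w, hw, rfl⟩ := mem_digitSpan_succ.1 hs
    have h_top : β ^ (a + m) * w ∈ digitSpan β W (a + m) := by
      have h := sub_mem (digitSpan_mono (Nat.le_add_left m a) hm) (pow_mul_mem_digitSpan hu m)
      convert h using 1
      ring
    obtain ⟨c, rfl⟩ := Nat.exists_eq_add_of_le h_ge
    have h_red := pow_mul_mem_digitSpan (hN w hw _ h_top) c
    rw [← mul_assoc, ← pow_add, add_comm c] at h_red
    exact ih (add_mem hu h_red)

end digitSpan

theorem betaEval_append {k : Type*} [Field k] (β : k) (x y : List k) :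
    betaEval β (x ++ y) = β ^ y.length * betaEval β x + betaEval β y := by
  induction y using List.reverseRecOn with
  | nil => simp [betaEval]
  | append_singleton y a ih =>
    have h_snoc (z : List k) : betaEval β (z ++ [a]) = β * betaEval β z + a := by
      simp [betaEval]
    rw [← List.append_assoc, h_snoc, h_snoc, ih, List.length_append, List.length_singleton]
    ring

/-- The difference of the values of the two components of a word over `A × A`. -/
def betaDiff {k : Type*} [Field k] (β : k) {A : Finset k} (w : List (↥A × ↥A)) : k :=
  betaEval β (w.map fun p => (p.1 : k)) - betaEval β (w.map fun p => (p.2 : k))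

section betaDiff

variable {k : Type*} [Field k] {β : k} {A : Finset k}

theorem mem_relLang_iff {w : List (↥A × ↥A)} : w ∈ relLang β A ↔ betaDiff β w = 0 :=
  sub_eq_zero.symm

theorem betaDiff_append (x y : List (↥A × ↥A)) :
    betaDiff β (x ++ y) = β ^ y.length * betaDiff β x + betaDiff β y := by
  simp only [betaDiff, List.map_append, betaEval_append, List.length_map]
  ring

theorem betaDiff_mem_digitSpan {R : Type*} [CommRing R] [Algebra R k] {W : Submodule R k}
    (hA : (A : Set k) ⊆ W) (w : List (↥A × ↥A)) : betaDiff β w ∈ digitSpan β W w.length := by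
  induction w with
  | nil => simp [betaDiff]
  | cons a w ih =>
    refine mem_digitSpan_succ.2 ⟨_, ih, _, sub_mem (hA a.1.2) (hA a.2.2), ?_⟩
    rw [← List.singleton_append, betaDiff_append]
    simp [betaDiff, betaEval, add_comm]

end betaDiff


/-- If `k` is a field of positive characteristic, `β ∈ k` is nonzero and `A ⊆ k` is any
finite subset, then the relation language `L(β, A)` is regular: the semigroup generated
by the maps `x ↦ βx + t`, `t ∈ A`, is strongly automatic. -/
theorem relLang_isRegular_of_charP_pos (k : Type*) [Field k] (p : ℕ) (hp : p ≠ 0)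
    [CharP k p] (β : k) (hβ : β ≠ 0) (A : Finset k) : (relLang β A).IsRegular := by
  have : Fact p.Prime := ⟨(CharP.char_is_prime_or_zero k p).resolve_right hp⟩
  let _ : Algebra (ZMod p) k := ZMod.algebra k p
  have finite_of_fg {V : Submodule (ZMod p) k} (hV : V.FG) : (V : Set k).Finite := by
    have : Module.Finite (ZMod p) V := Module.Finite.iff_fg.2 hV
    exact Set.finite_coe_iff.1 (Module.finite_of_finite (ZMod p))
  have hW : (Submodule.span (ZMod p) (A : Set k)).FG := ⟨A, rfl⟩
  obtain ⟨N, hN⟩ := exists_mem_digitSpan_of_pow_mul_mem (β := β) (finite_of_fg hW)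
  let Q (s : k) : Set (List (↥A × ↥A)) := {y | β ^ y.length * s + betaDiff β y = 0}
  refine Language.isRegular_iff_finite_range_leftQuotient.2 <|
    (((finite_of_fg (digitSpan_fg (β := β) hW N)).image Q).insert ∅).subset ?_
  rintro _ ⟨x, rfl⟩
  have hQ : (relLang β A).leftQuotient x = Q (betaDiff β x) := by
    ext y
    change x ++ y ∈ relLang β A ↔ _
    rw [mem_relLang_iff, betaDiff_append]
    rfl
  rw [hQ]
  rcases Set.eq_empty_or_nonempty (Q (betaDiff β x)) with h_empty | ⟨y, hy⟩
  · exact Or.inl h_empty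
  · refine Or.inr ⟨_, hN _ y.length _ (betaDiff_mem_digitSpan Submodule.subset_span x) ?_, rfl⟩
    rw [eq_neg_of_add_eq_zero_left hy]
    exact neg_mem (betaDiff_mem_digitSpan Submodule.subset_span y)
end

section
/- Let β be the unique real root greater than 1 of the polynomial X⁴ − 2X³ + X² − 2X + 1 (the Salem number β = (1 + √2 + √(2√2 − 1))/2 ≈ 1.8832035059). Then the relation language L(β, {0, 1}) is not regular; that is, the semigroup generated by the two affine maps x ↦ βx and x ↦ βx + 1 is not strongly automatic. -/
namespace SalemRelation

/-- Words of digits in `{-1, 0, 1}`. -/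
abbrev DigitWord := List SignType

/-- The ring embedding `a + b√2 ↦ a + b√2` of `ℤ√2` into `ℝ`. -/
noncomputable def emb : ℤ√2 →+* ℝ := Zsqrtd.lift ⟨√2, by norm_num⟩

lemma emb_apply (A : ℤ√2) : emb A = A.re + A.im * √2 := by
  simp [emb]

/-- The pair `(A, B)` stands for the element `A + B x` of `ℤ[√2][x] / (x² - (1 + √2) x + 1)`. -/
abbrev State := ℤ√2 × ℤ√2

/-- Multiplication by `x`. -/
def mulX (e : State) : State := (-e.2, e.1 + ⟨1, 1⟩ * e.2)

/-- Multiplication by the inverse of `x`. -/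
def divX (e : State) : State := (e.2 + ⟨1, 1⟩ * e.1, -e.1)

/-- The transition `e ↦ x e + g`. -/
def step (e : State) (g : SignType) : State := mulX e + ((g : ℤ√2), 0)

/-- The state reached from `e` by reading a word of digits. -/
def walk (e : State) (w : DigitWord) : State := w.foldl step e

/-- The element `v` such that reading `w` from `e` gives `xⁿ (e + v)`, where `n` is the length
of `w`. -/
def shift : DigitWord → State
  | [] => 0
  | g :: w => divX (((g : ℤ√2), 0) + shift w)

lemma mulX_divX (e : State) : mulX (divX e) = e := by
  simp [mulX, divX]

lemma mulX_add (e f : State) : mulX (e + f) = mulX e + mulX f := by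
  ext1
  · simp [mulX]; ring
  · simp [mulX]; ring

lemma walk_eq (w : DigitWord) : ∀ e, walk e w = mulX^[w.length] (e + shift w) := by
  induction w with
  | nil => intro e; simp [walk, shift]
  | cons g w ih =>
    intro e
    have h : walk e (g :: w) = walk (step e g) w := rfl
    rw [h, ih, List.length_cons, Function.iterate_succ_apply, mulX_add, shift, mulX_divX, step,
      add_assoc]

lemma iterate_mulX_zero (n : ℕ) : mulX^[n] 0 = 0 :=
  Function.iterate_fixed (by simp [mulX]) n

lemma walk_neg_shift (w : DigitWord) : walk (-shift w) w = 0 := by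
  rw [walk_eq, neg_add_cancel, iterate_mulX_zero]

lemma cast_neg_digit (g : SignType) : ((-g : SignType) : ℤ√2) = -(g : ℤ√2) := by
  cases g <;> rfl

lemma shift_map_neg (w : DigitWord) : shift (w.map (-·)) = -shift w := by
  induction w with
  | nil => simp [shift]
  | cons g w ih =>
    simp only [List.map_cons, shift, ih, cast_neg_digit]
    ext1 <;> simp [divX] <;> ring

/-- The state `e` has a path to `0`. -/
def Terminates (e : State) : Prop := ∃ w, walk e w = 0

lemma Terminates.of_walk {e : State} {w : DigitWord} (h : Terminates (walk e w)) :
    Terminates e := by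
  obtain ⟨u, hu⟩ := h
  exact ⟨w ++ u, by simpa [walk, List.foldl_append] using hu⟩

lemma terminates_neg_shift (w : DigitWord) : Terminates (-shift w) := ⟨w, walk_neg_shift w⟩

lemma terminates_shift (w : DigitWord) : Terminates (shift w) := by
  simpa [shift_map_neg] using terminates_neg_shift (w.map (-·))

lemma mulX_neg (e : State) : mulX (-e) = -mulX e := by
  ext1
  · simp [mulX]
  · simp [mulX]; ring

lemma iterate_mulX_neg (n : ℕ) (e : State) : mulX^[n] (-e) = -mulX^[n] e := by
  induction n generalizing e with
  | zero => rfl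
  | succ n ih => rw [Function.iterate_succ_apply, Function.iterate_succ_apply, mulX_neg, ih]

lemma Terminates.of_neg {e : State} (h : Terminates (-e)) : Terminates e := by
  obtain ⟨w, hw⟩ := h
  refine ⟨w.map (-·), ?_⟩
  rw [walk_eq, shift_map_neg, List.length_map, ← neg_eq_zero, ← iterate_mulX_neg, ← hw, walk_eq]
  congr 1
  abel

/-! ### Embeddings -/

/-- The value of a state at a real root `x` of `x² - (1 + √2) x + 1`. -/
noncomputable def evalAt (x : ℝ) (e : State) : ℝ := emb e.1 + emb e.2 * x

/-- The binary form `|p + q z|²` where `z + z⁻¹ = 1 - √2`, `|z| = 1`. -/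
noncomputable def form (p q : ℝ) : ℝ := p ^ 2 + q ^ 2 + (1 - √2) * p * q

/-- The square of the absolute value of a state at the nonreal places. -/
noncomputable def sqNorm (e : State) : ℝ := form (emb (star e.1)) (emb (star e.2))

lemma sqrt_two_sharp_bounds : (1.4142135623 : ℝ) ≤ √2 ∧ √2 ≤ 1.4142135624 :=
  ⟨Real.le_sqrt_of_sq_le (by norm_num), Real.sqrt_le_iff.2 (by norm_num)⟩

lemma sqrt_two_bounds : 141421356 ≤ √2 * 10 ^ 8 ∧ √2 * 10 ^ 8 ≤ 141421357 := by
  obtain ⟨h1, h2⟩ := sqrt_two_sharp_bounds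
  constructor <;> linarith

lemma form_nonneg (p q : ℝ) : 0 ≤ form p q := by
  obtain ⟨h1, h2⟩ := sqrt_two_bounds
  have h : form p q = (p + (1 - √2) / 2 * q) ^ 2 + (1 - ((1 - √2) / 2) ^ 2) * q ^ 2 := by
    unfold form; ring
  have h3 : 0 ≤ 1 - ((1 - √2) / 2) ^ 2 := by nlinarith
  rw [h]
  positivity

lemma emb_trace : emb ⟨1, 1⟩ = 1 + √2 := by simp [emb_apply]

lemma emb_star_trace : emb (star ⟨1, 1⟩) = 1 - √2 := by simp [emb_apply, sub_eq_add_neg]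

lemma sqNorm_mulX (e : State) : sqNorm (mulX e) = sqNorm e := by
  simp only [sqNorm, mulX, form, star_neg, star_add, star_mul', map_neg, map_add, map_mul,
    emb_star_trace]
  ring

lemma sqNorm_iterate (n : ℕ) (e : State) : sqNorm (mulX^[n] e) = sqNorm e := by
  induction n with
  | zero => rfl
  | succ n ih => rw [Function.iterate_succ_apply', sqNorm_mulX, ih]

lemma evalAt_add (x : ℝ) (e f : State) : evalAt x (e + f) = evalAt x e + evalAt x f := by
  simp [evalAt]; ring

lemma evalAt_neg (x : ℝ) (e : State) : evalAt x (-e) = -evalAt x e := by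
  simp [evalAt]; ring

lemma evalAt_mulX {x : ℝ} (hx : x ^ 2 = (1 + √2) * x - 1) (e : State) :
    evalAt x (mulX e) = x * evalAt x e := by
  simp only [evalAt, mulX, map_neg, map_add, map_mul]
  rw [emb_trace]
  linear_combination (-emb e.2) * hx

lemma evalAt_iterate {x : ℝ} (hx : x ^ 2 = (1 + √2) * x - 1) (n : ℕ) (e : State) :
    evalAt x (mulX^[n] e) = x ^ n * evalAt x e := by
  induction n with
  | zero => simp
  | succ n ih => rw [Function.iterate_succ_apply', evalAt_mulX hx, ih]; ring

lemma evalAt_step {x : ℝ} (hx : x ^ 2 = (1 + √2) * x - 1) (e : State) (g : SignType) :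
    evalAt x (step e g) = x * evalAt x e + (g : ℝ) := by
  rw [step, evalAt_add, evalAt_mulX hx]
  cases g <;> simp [evalAt]

lemma foldl_eval {k : Type*} [Field k] (β : k) (w : List k) : ∀ s,
    w.foldl (fun acc a => β * acc + a) s = β ^ w.length * s + betaEval β w := by
  induction w using List.reverseRecOn with
  | nil => simp [betaEval]
  | append_singleton w a ih =>
    intro s
    simp only [betaEval, List.foldl_append, List.foldl_cons, List.foldl_nil, List.length_append,
      List.length_singleton] at ih ⊢
    rw [ih]; ring

lemma betaEval_append {k : Type*} [Field k] (β : k) (u w : List k) :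
    betaEval β (u ++ w) = β ^ w.length * betaEval β u + betaEval β w := by
  rw [← foldl_eval, betaEval, betaEval, List.foldl_append]

lemma betaEval_cons {k : Type*} [Field k] (β a : k) (w : List k) :
    betaEval β (a :: w) = β ^ w.length * a + betaEval β w := by
  have := betaEval_append β [a] w
  simpa [betaEval] using this

/-- The value at `x` of a word of digits. -/
noncomputable def wordEval (x : ℝ) (w : DigitWord) : ℝ := betaEval x (w.map fun g => (g : ℝ))

lemma wordEval_append (x : ℝ) (u w : DigitWord) :
    wordEval x (u ++ w) = x ^ w.length * wordEval x u + wordEval x w := by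
  simp [wordEval, betaEval_append]

lemma wordEval_cons (x : ℝ) (g : SignType) (w : DigitWord) :
    wordEval x (g :: w) = x ^ w.length * g + wordEval x w := by
  simp [wordEval, betaEval_cons]

lemma wordEval_map_neg (x : ℝ) (w : DigitWord) : wordEval x (w.map (-·)) = -wordEval x w := by
  induction w with
  | nil => simp [wordEval, betaEval]
  | cons g w ih =>
    have hg : ((-g : SignType) : ℝ) = -(g : ℝ) := by cases g <;> simp
    rw [List.map_cons, wordEval_cons, wordEval_cons, ih, hg, List.length_map]
    ring

lemma evalAt_walk {x : ℝ} (hx : x ^ 2 = (1 + √2) * x - 1) (w : DigitWord) : ∀ e,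
    evalAt x (walk e w) = x ^ w.length * evalAt x e + wordEval x w := by
  induction w with
  | nil => intro e; simp [walk, wordEval, betaEval]
  | cons g w ih =>
    intro e
    have h : walk e (g :: w) = walk (step e g) w := rfl
    rw [h, ih, evalAt_step hx, wordEval_cons, List.length_cons]
    ring

/-! ### Certified approximations -/

/-- A lower bound of `10⁸` times the value of a state at the Salem number. -/
def lower (e : State) : ℤ :=
  e.1.re * 10 ^ 8 + e.1.im * 141421356 + e.2.re * 188320350 + e.2.im * 266325193
    - |e.1.im| - |e.2.re| - |e.2.im|

/-- An upper bound of `10⁸` times the value of a state at the Salem number. -/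
def upper (e : State) : ℤ :=
  e.1.re * 10 ^ 8 + e.1.im * 141421356 + e.2.re * 188320350 + e.2.im * 266325193
    + |e.1.im| + |e.2.re| + |e.2.im|

lemma abs_mul_sub_le {x m : ℝ} (h : m ≤ x ∧ x ≤ m + 1) (k : ℤ) : |k * x - k * m| ≤ |(k : ℝ)| := by
  rw [← mul_sub, abs_mul]
  refine mul_le_of_le_one_right (abs_nonneg _) (abs_le.2 ⟨?_, ?_⟩) <;> linarith [h.1, h.2]

/-- `β` is the root greater than `1` of `x² - (1 + √2) x + 1`. -/
def IsSalem (β : ℝ) : Prop := 1 < β ∧ β ^ 2 = (1 + √2) * β - 1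

lemma isSalem_of_root {β : ℝ} (hβ : 1 < β)
    (hroot : β ^ 4 - 2 * β ^ 3 + β ^ 2 - 2 * β + 1 = 0) : IsSalem β := by
  refine ⟨hβ, ?_⟩
  have h1 : (β ^ 2 - β + 1) ^ 2 = (√2 * β) ^ 2 := by
    rw [mul_pow, Real.sq_sqrt zero_le_two]; linear_combination hroot
  have h2 : β ^ 2 - β + 1 = √2 * β :=
    (pow_left_inj₀ (by nlinarith) (by positivity) two_ne_zero).1 h1
  linear_combination h2

namespace IsSalem

lemma pos {β : ℝ} (h : IsSalem β) : 0 < β := one_pos.trans h.1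

lemma sharp_bounds {β : ℝ} (h : IsSalem β) : (1.883203505 : ℝ) ≤ β ∧ β ≤ 1.883203506 := by
  obtain ⟨h1, h2⟩ := h
  obtain ⟨h3, h4⟩ := sqrt_two_sharp_bounds
  constructor
  · by_contra! hc
    nlinarith [mul_pos (sub_pos.2 h1) (sub_pos.2 hc),
      mul_le_mul_of_nonneg_right h3 (by linarith : 0 ≤ β)]
  · by_contra! hc
    nlinarith [mul_le_mul_of_nonneg_right h4 (by linarith : 0 ≤ β)]

lemma bounds {β : ℝ} (h : IsSalem β) :
    (188320350 : ℝ) ≤ β * 10 ^ 8 ∧ β * 10 ^ 8 ≤ 188320350 + 1 := by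
  obtain ⟨h1, h2⟩ := h.sharp_bounds
  constructor <;> linarith

lemma mul_bounds {β : ℝ} (h : IsSalem β) :
    (266325193 : ℝ) ≤ √2 * β * 10 ^ 8 ∧ √2 * β * 10 ^ 8 ≤ 266325193 + 1 := by
  obtain ⟨h1, h2⟩ := h.sharp_bounds
  obtain ⟨h3, h4⟩ := sqrt_two_sharp_bounds
  have h5 := mul_le_mul h3 h1 (by norm_num) (by positivity)
  have h6 := mul_le_mul h4 h2 h.pos.le (by norm_num)
  constructor <;> linarith

lemma abs_approx {β : ℝ} (h : IsSalem β) (e : State) :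
    |evalAt β e * 10 ^ 8 - (e.1.re * 10 ^ 8 + e.1.im * 141421356 +
    e.2.re * 188320350 + e.2.im * 266325193)| ≤
    |(e.1.im : ℝ)| + |(e.2.re : ℝ)| + |(e.2.im : ℝ)| := by
  have h1 := abs_mul_sub_le (x := √2 * 10 ^ 8) (m := 141421356)
    (by have := sqrt_two_bounds; constructor <;> linarith) e.1.im
  have h2 := abs_mul_sub_le h.bounds e.2.re
  have h3 := abs_mul_sub_le h.mul_bounds e.2.im
  refine le_trans (le_of_eq ?_) ((abs_add_three _ _ _).trans (add_le_add (add_le_add h1 h2) h3))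
  simp only [evalAt, emb_apply]
  congr 1
  ring

lemma lower_le {β : ℝ} (h : IsSalem β) (e : State) : lower e ≤ evalAt β e * 10 ^ 8 := by
  have := abs_le.1 (h.abs_approx e)
  simp only [lower]
  push_cast
  linarith

lemma le_upper {β : ℝ} (h : IsSalem β) (e : State) : evalAt β e * 10 ^ 8 ≤ upper e := by
  have := abs_le.1 (h.abs_approx e)
  simp only [upper]
  push_cast
  linarith

lemma emb_pos {β : ℝ} (h : IsSalem β) {A : ℤ√2} (hA : 0 < lower (A, 0)) : 0 < emb A := by
  have h1 := h.lower_le (A, 0)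
  have h2 : (0 : ℝ) < lower (A, 0) := mod_cast hA
  simp only [evalAt, map_zero, zero_mul, add_zero] at h1
  linarith

end IsSalem

/-! ### Steering -/

/-- An affine form `a p + b q + c` in two variables, with coefficients in `ℤ√2`. -/
abbrev AffineForm := ℤ√2 × ℤ√2 × ℤ√2

/-- The value of the conjugate of an affine form. -/
noncomputable def AffineForm.conjEval (l : AffineForm) (p q : ℝ) : ℝ :=
  emb (star l.1) * p + emb (star l.2.1) * q + emb (star l.2.2)

/-- The affine form that is positive at the conjugates of the states whose square norm is not
decreased by `1 / 20` or more by the word with shift `v`. -/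
def stuckForm (v : State) : AffineForm :=
  (20 * (2 * v.1 + ⟨1, 1⟩ * v.2), 20 * (2 * v.2 + ⟨1, 1⟩ * v.1),
    20 * (v.1 ^ 2 + v.2 ^ 2 + ⟨1, 1⟩ * v.1 * v.2) + 1)

lemma conjEval_stuckForm_pos {e : State} {w : DigitWord}
    (hw : sqNorm e - 1 / 20 < sqNorm (walk e w)) :
    0 < (stuckForm (shift w)).conjEval (emb (star e.1)) (emb (star e.2)) := by
  rw [walk_eq, sqNorm_iterate] at hw
  generalize shift w = v at *
  simp only [sqNorm, form, Prod.fst_add, Prod.snd_add, star_add, map_add] at hw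
  simp only [AffineForm.conjEval, stuckForm, star_add, star_mul', star_pow, map_add, map_mul,
    map_pow, emb_star_trace, star_one, map_one, star_ofNat, map_ofNat]
  linarith

/-- The determinant of the linear parts of two affine forms. -/
def AffineForm.det (l m : AffineForm) : ℤ√2 := l.1 * m.2.1 - l.2.1 * m.1

/-- The linear parts of two affine forms form a positive basis, and their common zero
has coordinates smaller than `6` in absolute value. -/
abbrev AffineForm.GoodVertex (l m : AffineForm) : Prop :=
  0 < lower (star (l.det m), 0) ∧
  0 < lower (star (6 * l.det m + (l.2.1 * m.2.2 - m.2.1 * l.2.2)), 0) ∧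
  0 < lower (star (6 * l.det m - (l.2.1 * m.2.2 - m.2.1 * l.2.2)), 0) ∧
  0 < lower (star (6 * l.det m + (l.1 * m.2.2 - m.1 * l.2.2)), 0) ∧
  0 < lower (star (6 * l.det m - (l.1 * m.2.2 - m.1 * l.2.2)), 0)

lemma abs_le_of_weights {x x₁ x₂ x₃ w₁ w₂ w₃ d₁ d₂ d₃ K : ℝ} (hw₁ : 0 < w₁) (hw₂ : 0 < w₂)
    (hw₃ : 0 < w₃) (hd₁ : 0 < d₁) (hd₂ : 0 < d₂) (hd₃ : 0 < d₃)
    (hx : x * (w₁ * d₁ + w₂ * d₂ + w₃ * d₃) = w₁ * x₁ + w₂ * x₂ + w₃ * x₃)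
    (h₁ : |x₁| ≤ K * d₁) (h₂ : |x₂| ≤ K * d₂) (h₃ : |x₃| ≤ K * d₃) : |x| ≤ K := by
  have hT : 0 < w₁ * d₁ + w₂ * d₂ + w₃ * d₃ := by positivity
  rw [abs_le] at *
  constructor
  · refine le_of_mul_le_mul_right ?_ hT
    nlinarith
  · refine le_of_mul_le_mul_right ?_ hT
    nlinarith

lemma AffineForm.GoodVertex.emb_bounds {β : ℝ} (hβ : IsSalem β) {l m : AffineForm}
    (h : l.GoodVertex m) : 0 < emb (star (l.det m)) ∧
    |emb (star (l.2.1 * m.2.2 - m.2.1 * l.2.2))| ≤ 6 * emb (star (l.det m)) ∧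
    |emb (star (m.1 * l.2.2 - l.1 * m.2.2))| ≤ 6 * emb (star (l.det m)) := by
  obtain ⟨h₁, h₂, h₃, h₄, h₅⟩ := h
  replace h₁ := hβ.emb_pos h₁
  replace h₂ := hβ.emb_pos h₂
  replace h₃ := hβ.emb_pos h₃
  replace h₄ := hβ.emb_pos h₄
  replace h₅ := hβ.emb_pos h₅
  simp only [star_add, star_sub, star_mul', map_add, map_sub, map_mul, star_ofNat, map_ofNat]
    at h₁ h₂ h₃ h₄ h₅ ⊢
  exact ⟨h₁, abs_le.2 ⟨by linarith, by linarith⟩, abs_le.2 ⟨by linarith, by linarith⟩⟩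

lemma abs_le_six {β : ℝ} (hβ : IsSalem β) {l m n : AffineForm} (hlm : l.GoodVertex m)
    (hmn : m.GoodVertex n) (hnl : n.GoodVertex l) {p q : ℝ} (hl : 0 < l.conjEval p q)
    (hm : 0 < m.conjEval p q) (hn : 0 < n.conjEval p q) : |p| ≤ 6 ∧ |q| ≤ 6 := by
  obtain ⟨a₁, a₂, a₃⟩ := hlm.emb_bounds hβ
  obtain ⟨b₁, b₂, b₃⟩ := hmn.emb_bounds hβ
  obtain ⟨c₁, c₂, c₃⟩ := hnl.emb_bounds hβ
  refine ⟨abs_le_of_weights hl hm hn b₁ c₁ a₁ ?_ b₂ c₂ a₂,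
    abs_le_of_weights hl hm hn b₁ c₁ a₁ ?_ b₃ c₃ a₃⟩ <;>
  · simp only [AffineForm.conjEval, AffineForm.det, star_sub, star_mul', map_sub, map_mul]
    ring

/-- The state of value `x⁻ⁿ`. -/
def kappa (n : ℕ) : State := divX^[n] (1, 0)

lemma IsSalem.inv_eq {β : ℝ} (h : IsSalem β) : β⁻¹ = 1 + √2 - β :=
  inv_eq_of_mul_eq_one_right (by linear_combination -h.2)

lemma IsSalem.inv_sq {β : ℝ} (h : IsSalem β) : β⁻¹ ^ 2 = (1 + √2) * β⁻¹ - 1 := by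
  rw [h.inv_eq]
  linear_combination h.2

lemma IsSalem.pow_mul_evalAt_kappa {β : ℝ} (h : IsSalem β) (n : ℕ) :
    β ^ n * evalAt β (kappa n) = 1 := by
  rw [← evalAt_iterate h.2, kappa, Function.LeftInverse.iterate mulX_divX n]
  simp [evalAt]

/-- Reading `w` keeps the value of a state in `[-1, 1]` if it starts in
`[lo / 1000, hi / 1000]`. -/
abbrev Admissible (lo hi : ℤ) (w : DigitWord) : Prop :=
  upper (shift w) * 1000 + hi * 10 ^ 8 ≤ 1000 * lower (kappa w.length) ∧
  -1000 * lower (kappa w.length) ≤ lower (shift w) * 1000 + lo * 10 ^ 8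

lemma Admissible.abs_evalAt_walk_le {β : ℝ} (hβ : IsSalem β) {lo hi : ℤ} {w : DigitWord}
    (hw : Admissible lo hi w) {e : State} (hlo : lo ≤ 1000 * evalAt β e)
    (hhi : 1000 * evalAt β e ≤ hi) : |evalAt β (walk e w)| ≤ 1 := by
  have h₁ : (upper (shift w) * 1000 + hi * 10 ^ 8 : ℝ) ≤ 1000 * lower (kappa w.length) :=
    mod_cast hw.1
  have h₂ : (-1000 * lower (kappa w.length) : ℝ) ≤ lower (shift w) * 1000 + lo * 10 ^ 8 :=
    mod_cast hw.2
  have h₃ := hβ.lower_le (kappa w.length)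
  have h₄ := hβ.lower_le (shift w)
  have h₅ := hβ.le_upper (shift w)
  rw [walk_eq, evalAt_iterate hβ.2, evalAt_add, ← hβ.pow_mul_evalAt_kappa w.length, abs_mul,
    abs_of_pos (pow_pos hβ.pos _)]
  refine mul_le_mul_of_nonneg_left (abs_le.2 ⟨?_, ?_⟩) (pow_pos hβ.pos _).le <;> linarith

/-- An interval of values, in thousandths, with three words to be read from states with a value
in this interval. -/
structure Cell where
  lo : ℤ
  hi : ℤ
  fst : DigitWord
  snd : DigitWord
  trd : DigitWord

/-- The three words of a cell are admissible, and can be read to decrease the square norm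
outside of a bounded triangle. -/
abbrev Cell.Good (c : Cell) : Prop :=
  (Admissible c.lo c.hi c.fst ∧ Admissible c.lo c.hi c.snd ∧ Admissible c.lo c.hi c.trd) ∧
  (stuckForm (shift c.fst)).GoodVertex (stuckForm (shift c.snd)) ∧
  (stuckForm (shift c.snd)).GoodVertex (stuckForm (shift c.trd)) ∧
  (stuckForm (shift c.trd)).GoodVertex (stuckForm (shift c.fst))

/-- A subdivision of the values in `[0, 1]`. -/
def cells : List Cell :=
  [⟨0, 149, [0, 0, -1, 1], [0, -1, 1], [-1, 1]⟩,
   ⟨149, 299, [0, 0, -1], [0, -1], [-1]⟩,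
   ⟨299, 548, [-1, 1, -1], [0, -1, -1], [-1]⟩,
   ⟨548, 680, [-1, 0, -1, 1], [-1], [-1, 0, -1]⟩,
   ⟨680, 733, [-1, -1, 0, 1, 1], [-1], [-1, 0, -1]⟩,
   ⟨733, 762, [-1, -1, 0, 1], [-1], [-1, 0, -1, -1, 1, -1]⟩,
   ⟨762, 778, [-1, 0, -1, -1, 0, -1], [-1, -1, 0, 1, 0, -1], [-1, -1, 0, 0, 1]⟩,
   ⟨778, 815, [-1, -1, 0, 0, 1, -1], [-1], [-1, 0, -1]⟩,
   ⟨815, 883, [-1, -1, 0, -1, 1], [-1, -1, -1, 1, 1], [-1, -1, -1]⟩,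
   ⟨883, 962, [-1], [-1, -1, -1, 0, 1], [-1, -1, -1]⟩,
   ⟨962, 1000, [-1], [-1, -1, -1, -1, 1], [-1, -1, -1]⟩]

lemma good_of_mem_cells : ∀ c ∈ cells, c.Good := by decide +kernel

lemma exists_cell {y : ℝ} (h₀ : 0 ≤ y) (h₁ : y ≤ 1) :
    ∃ c ∈ cells, (c.lo : ℝ) ≤ 1000 * y ∧ 1000 * y ≤ c.hi := by
  by_contra! h
  simp only [cells, List.forall_mem_cons, List.not_mem_nil, IsEmpty.forall_iff, implies_true,
    and_true, Int.cast_ofNat, Int.cast_zero] at h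
  grind

lemma Cell.Good.steer {β : ℝ} (hβ : IsSalem β) {c : Cell} (hc : c.Good) {e : State}
    (hlo : c.lo ≤ 1000 * evalAt β e) (hhi : 1000 * evalAt β e ≤ c.hi) :
    (∃ w, |evalAt β (walk e w)| ≤ 1 ∧ sqNorm (walk e w) ≤ sqNorm e - 1 / 20) ∨
      |emb (star e.1)| ≤ 6 ∧ |emb (star e.2)| ≤ 6 := by
  obtain ⟨⟨h₁, h₂, h₃⟩, h₁₂, h₂₃, h₃₁⟩ := hc
  by_contra! h
  obtain ⟨h, h'⟩ := h
  have key {w : DigitWord} (hw : Admissible c.lo c.hi w) :=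
    conjEval_stuckForm_pos (h w (hw.abs_evalAt_walk_le hβ hlo hhi))
  obtain ⟨h₄, h₅⟩ := abs_le_six hβ h₁₂ h₂₃ h₃₁ (key h₁) (key h₂) (key h₃)
  exact (h' h₄).not_ge h₅

/-! ### The finite core -/

/-- The image of a state under `x ↦ x⁻¹`. -/
def recip (e : State) : State := (e.1 + ⟨1, 1⟩ * e.2, -e.2)

lemma IsSalem.evalAt_inv {β : ℝ} (h : IsSalem β) (e : State) :
    evalAt β⁻¹ e = evalAt β (recip e) := by
  simp only [evalAt, recip, h.inv_eq, map_add, map_mul, map_neg, emb_trace]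
  ring

/-- An approximate test for `evalAt β e ∈ [0, 1]`, `|evalAt β⁻¹ e| ≤ 11 / 5` and the conjugates of
both coordinates being bounded by `6`. -/
abbrev CoreTest (e : State) : Prop :=
  0 ≤ upper e ∧ lower e ≤ 10 ^ 8 ∧
  5 * lower (recip e) ≤ 11 * 10 ^ 8 ∧ -11 * 10 ^ 8 ≤ 5 * upper (recip e) ∧
  0 ≤ upper (star (6 + e.1), 0) ∧ 0 ≤ upper (star (6 - e.1), 0) ∧
  0 ≤ upper (star (6 + e.2), 0) ∧ 0 ≤ upper (star (6 - e.2), 0)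

/-- Words whose suffixes lead from all states of the core to `0`, up to sign. -/
def coreWords : List DigitWord :=
  [[0, 0, -1, 1, -1, -1, -1, 0, -1, -1, 1, -1, -1, 1, 1, -1, 0, 1, 0, 1, 1, 1, -1],
   [-1, -1, -1, -1, 1, 0, 1, 1, -1, -1, 1, 0, -1, 0, -1, -1, -1, 1],
   [-1, 0, 0, 0, 0, 1, 1, -1, -1, 1, 0, -1, 0, -1, -1, -1, 1],
   [-1, -1, 0, 1, 0, -1, 1, 1, 0, 0, 0, 1, -1, 0, 1, 0, 1, 1, 1, -1],
   [-1, 0, 1, 1, 1, -1, 1, 1, -1, -1, 1, 0, -1, 0, -1, -1, -1, 1],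
   [-1, -1, -1, 0, 1, 0, -1, 0, -1, -1, -1, 1],
   [-1, 0, -1, 1, 0, -1, 0, -1, -1, -1, 1],
   [-1, 1, -1, -1, -1, 0, -1, 1, 1, -1, 0, 1, 0, 1, 1, 1, -1],
   [-1, -1, 1, -1, 1, 1, 0, 0, 0, 1, -1, 0, 1, 0, 1, 1, 1, -1],
   [-1, -1, -1, -1, 1],
   [0, 0, -1, 0, -1, -1, -1, 1],
   [-1, -1, -1, 1, 1, -1, 0, 1, 0, 1, 1, 1, -1],
   [-1, 0, -1, -1, 1, 0, -1, -1, 1, 1, -1, 0, 1, 0, 1, 1, 1, -1],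
   [-1, 1, 0, -1, 1, 1, 0, 0, 0, 1, -1, 0, 1, 0, 1, 1, 1, -1],
   [-1, 0, 0, -1, 1, 0, -1, 0, -1, -1, -1, 1],
   [-1, -1, -1, 1, 0, -1, -1, 1, 1, -1, 0, 1, 0, 1, 1, 1, -1],
   [-1, -1, 0, -1, 0, 0, 0, -1, 1, 0, -1, 0, -1, -1, -1, 1],
   [-1, 1, 0, 1, 1, 1, -1],
   [-1, 0, 0, 1, 1, -1, -1, 1, 0, -1, 0, -1, -1, -1, 1],
   [-1, -1, 0, -1, -1, 0, -1, -1, 1, -1, -1, 1, 1, -1, 0, 1, 0, 1, 1, 1, -1],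
   [-1, 0, 0, 0, 1, 1, -1, -1, 1, 0, -1, 0, -1, -1, -1, 1],
   [-1, 0, -1, -1, -1, 0, -1, 1, 1, -1, 0, 1, 0, 1, 1, 1, -1],
   [0, 0, -1, 1, 1, 0, 0, 0, 1, -1, 0, 1, 0, 1, 1, 1, -1]]

/-- States with a path to `0`. -/
def coreStates : List State := (coreWords.flatMap List.tails).map shift

lemma terminates_of_mem_coreStates {e : State} (h : e ∈ coreStates) : Terminates e := by
  obtain ⟨w, -, rfl⟩ := List.mem_map.1 h
  exact terminates_shift w

lemma mem_coreStates_of_coreTest : ∀ a ∈ Finset.Icc (-4 : ℤ) 4, ∀ b ∈ Finset.Icc (-3 : ℤ) 3,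
    ∀ c ∈ Finset.Icc (-4 : ℤ) 4, ∀ d ∈ Finset.Icc (-2 : ℤ) 2, CoreTest (⟨a, b⟩, ⟨c, d⟩) →
      (⟨a, b⟩, ⟨c, d⟩) ∈ coreStates ∨ -(⟨a, b⟩, ⟨c, d⟩) ∈ coreStates := by
  decide +kernel

lemma IsSalem.upper_star_nonneg {β : ℝ} (h : IsSalem β) {A : ℤ√2} (hA : 0 ≤ emb (star A)) :
    0 ≤ upper (star A, 0) := by
  have := h.le_upper (star A, 0)
  simp only [evalAt, map_zero, zero_mul, add_zero] at this
  have : (0 : ℝ) ≤ upper (star A, 0) := by linarith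
  exact_mod_cast this

lemma abs_re_im_le {A : ℤ√2} {K L : ℝ} (h : |emb A| ≤ K) (h' : |emb (star A)| ≤ L) :
    2 * |(A.re : ℝ)| ≤ K + L ∧ 2 * √2 * |(A.im : ℝ)| ≤ K + L := by
  constructor
  · rw [← abs_two, ← abs_mul]
    refine le_trans (le_of_eq ?_) ((abs_add_le _ _).trans (add_le_add h h'))
    simp only [emb_apply, Zsqrtd.re_star, Zsqrtd.im_star, Int.cast_neg]
    congr 1
    ring
  · rw [← abs_of_pos (show 0 < 2 * √2 by positivity), ← abs_mul]
    refine le_trans (le_of_eq ?_) ((abs_sub _ _).trans (add_le_add h h'))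
    simp only [emb_apply, Zsqrtd.re_star, Zsqrtd.im_star, Int.cast_neg]
    congr 1
    ring

lemma IsSalem.inv_bounds {β : ℝ} (h : IsSalem β) : (0.53 : ℝ) ≤ β⁻¹ ∧ β⁻¹ ≤ 0.5311 := by
  obtain ⟨h1, h2⟩ := h.sharp_bounds
  obtain ⟨h3, h4⟩ := sqrt_two_sharp_bounds
  rw [h.inv_eq]
  constructor <;> linarith

lemma IsSalem.abs_emb_le {β : ℝ} (h : IsSalem β) {e : State} (h₁ : |evalAt β e| ≤ 1)
    (h₂ : |evalAt β⁻¹ e| ≤ 11 / 5) : |emb e.1| ≤ 3.47 ∧ |emb e.2| ≤ 2.38 := by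
  obtain ⟨h3, h4⟩ := h.sharp_bounds
  obtain ⟨h5, h6⟩ := h.inv_bounds
  have hpos : 0 < β - β⁻¹ := by linarith
  have hA : emb e.1 * (β - β⁻¹) = β * evalAt β⁻¹ e - β⁻¹ * evalAt β e := by
    simp only [evalAt]; ring
  have hB : emb e.2 * (β - β⁻¹) = evalAt β e - evalAt β⁻¹ e := by
    simp only [evalAt]; ring
  have hA' : |emb e.1| * (β - β⁻¹) ≤ β * (11 / 5) + β⁻¹ * 1 := by
    rw [← abs_of_pos hpos, ← abs_mul, hA]
    refine (abs_sub _ _).trans ?_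
    rw [abs_mul, abs_mul, abs_of_pos h.pos, abs_of_pos (inv_pos.2 h.pos)]
    have := h.pos
    gcongr
  have hB' : |emb e.2| * (β - β⁻¹) ≤ 1 + 11 / 5 := by
    rw [← abs_of_pos hpos, ← abs_mul, hB]
    exact (abs_sub _ _).trans (add_le_add h₁ h₂)
  constructor
  · by_contra! hc
    nlinarith
  · by_contra! hc
    nlinarith

lemma terminates_of_bounded {β : ℝ} (h : IsSalem β) {e : State} (h₀ : 0 ≤ evalAt β e)
    (h₁ : evalAt β e ≤ 1) (h₂ : |evalAt β⁻¹ e| ≤ 11 / 5) (h₃ : |emb (star e.1)| ≤ 6)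
    (h₄ : |emb (star e.2)| ≤ 6) : Terminates e := by
  obtain ⟨hA, hB⟩ := h.abs_emb_le (abs_le.2 ⟨by linarith, h₁⟩) h₂
  obtain ⟨ha, hb⟩ := abs_re_im_le hA h₃
  obtain ⟨hc, hd⟩ := abs_re_im_le hB h₄
  have hs := sqrt_two_sharp_bounds.1
  replace ha : |e.1.re| < 5 := by
    rw [← Int.cast_lt (R := ℝ)]; push_cast; linarith
  replace hb : |e.1.im| < 4 := by
    rw [← Int.cast_lt (R := ℝ)]; push_cast; nlinarith [abs_nonneg (e.1.im : ℝ)]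
  replace hc : |e.2.re| < 5 := by
    rw [← Int.cast_lt (R := ℝ)]; push_cast; linarith
  replace hd : |e.2.im| < 3 := by
    rw [← Int.cast_lt (R := ℝ)]; push_cast; nlinarith [abs_nonneg (e.2.im : ℝ)]
  rw [abs_lt] at ha hb hc hd
  have htest : CoreTest e := by
    have u₁ := h.le_upper e
    have l₁ := h.lower_le e
    have u₂ := h.le_upper (recip e)
    have l₂ := h.lower_le (recip e)
    rw [← h.evalAt_inv] at u₂ l₂
    rw [abs_le] at h₂ h₃ h₄
    refine ⟨?_, ?_, ?_, ?_, h.upper_star_nonneg ?_, h.upper_star_nonneg ?_,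
      h.upper_star_nonneg ?_, h.upper_star_nonneg ?_⟩
    · rw [← Int.cast_le (R := ℝ)]; push_cast; linarith
    · rw [← Int.cast_le (R := ℝ)]; push_cast; linarith
    · rw [← Int.cast_le (R := ℝ)]; push_cast; linarith
    · rw [← Int.cast_le (R := ℝ)]; push_cast; linarith
    all_goals
      simp only [star_add, star_sub, star_ofNat, map_add, map_sub, map_ofNat]
      linarith
  obtain hm | hm := mem_coreStates_of_coreTest e.1.re (Finset.mem_Icc.2 (by omega)) e.1.im
    (Finset.mem_Icc.2 (by omega)) e.2.re (Finset.mem_Icc.2 (by omega)) e.2.im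
    (Finset.mem_Icc.2 (by omega)) htest
  · exact terminates_of_mem_coreStates hm
  · exact (terminates_of_mem_coreStates hm).of_neg

/-! ### Termination -/

lemma IsSalem.abs_evalAt_inv_walk_le {β : ℝ} (h : IsSalem β) (w : DigitWord) :
    ∀ e, |evalAt β⁻¹ e| ≤ 11 / 5 → |evalAt β⁻¹ (walk e w)| ≤ 11 / 5 := by
  induction w with
  | nil => exact fun e he => he
  | cons g w ih =>
    refine fun e he => ih (step e g) ?_
    obtain ⟨h1, h2⟩ := h.inv_bounds
    have hg : |(g : ℝ)| ≤ 1 := by cases g <;> simp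
    rw [evalAt_step h.inv_sq]
    refine (abs_add_le _ _).trans ?_
    rw [abs_mul, abs_of_pos (inv_pos.2 h.pos)]
    nlinarith [abs_nonneg (evalAt β⁻¹ e)]

lemma terminates {β : ℝ} (h : IsSalem β) {e : State} (h₁ : |evalAt β e| ≤ 1)
    (h₂ : |evalAt β⁻¹ e| ≤ 11 / 5) : Terminates e := by
  obtain ⟨n, hn⟩ := exists_nat_gt (20 * sqNorm e)
  induction n generalizing e with
  | zero =>
    have : 0 ≤ sqNorm e := form_nonneg _ _
    norm_num at hn
    linarith
  | succ n ih =>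
    wlog h₀ : 0 ≤ evalAt β e generalizing e
    · refine Terminates.of_neg (this ?_ ?_ ?_ ?_)
      · rwa [evalAt_neg, abs_neg]
      · rwa [evalAt_neg, abs_neg]
      · convert hn using 2
        simp [sqNorm, form]
      · rw [evalAt_neg]
        linarith
    obtain ⟨c, hc, hlo, hhi⟩ := exists_cell h₀ (abs_le.1 h₁).2
    obtain ⟨w, hw, hw'⟩ | ⟨h₃, h₄⟩ := (good_of_mem_cells c hc).steer h hlo hhi
    · refine Terminates.of_walk (ih hw (h.abs_evalAt_inv_walk_le w e h₂) ?_)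
      push_cast at hn
      linarith
    · exact terminates_of_bounded h h₀ (abs_le.1 h₁).2 h₂ h₃ h₄

/-! ### Words of pairs -/

/-- A pair of digits in `{0, 1}` with the given difference. -/
noncomputable def toPair : SignType → ({0, 1} : Finset ℝ) × ({0, 1} : Finset ℝ)
  | 1 => (⟨1, by simp⟩, ⟨0, by simp⟩)
  | 0 => (⟨0, by simp⟩, ⟨0, by simp⟩)
  | -1 => (⟨0, by simp⟩, ⟨1, by simp⟩)

lemma toPair_sub (g : SignType) : ((toPair g).1 : ℝ) - (toPair g).2 = g := by
  cases g <;> simp [toPair]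

lemma wordEval_reverse {x : ℝ} (hx : x ≠ 0) (w : DigitWord) :
    wordEval x (w.reverse ++ [0]) = x ^ w.length * wordEval x⁻¹ w := by
  have hsingle (g : SignType) : wordEval x [g] = g := by simp [wordEval, betaEval]
  suffices h : x * wordEval x w.reverse = x ^ w.length * wordEval x⁻¹ w by
    simpa [wordEval_append, hsingle] using h
  induction w with
  | nil => simp [wordEval, betaEval]
  | cons g w ih =>
    have hpow := pow_ne_zero w.length hx
    rw [List.reverse_cons, wordEval_append, hsingle, wordEval_cons, List.length_singleton, pow_one,
      mul_add, ih, List.length_cons, inv_pow]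
    field_simp
    ring

lemma toPair_mem_relLang_iff {β : ℝ} (w : DigitWord) :
    w.map toPair ∈ relLang β {0, 1} ↔ wordEval β w = 0 := by
  suffices h : betaEval β ((w.map toPair).map fun p => (p.1 : ℝ)) -
      betaEval β ((w.map toPair).map fun p => (p.2 : ℝ)) = wordEval β w by
    rw [← h, sub_eq_zero]
    rfl
  induction w with
  | nil => simp [wordEval, betaEval]
  | cons g w ih =>
    rw [wordEval_cons, ← ih, ← toPair_sub]
    simp only [List.map_cons, betaEval_cons, List.length_map]
    ring

lemma IsSalem.exists_words {β : ℝ} (h : IsSalem β) (n : ℕ) : ∃ u w : DigitWord,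
    wordEval β u = (√2 - 1) ^ n ∧ β ^ w.length * (√2 - 1) ^ n + wordEval β w = 0 := by
  have hs := sqrt_two_sharp_bounds
  have heval (x : ℝ) : evalAt x (⟨-1, 1⟩ ^ n, 0) = (√2 - 1) ^ n := by
    simp [evalAt, emb_apply ⟨-1, 1⟩, neg_add_eq_sub]
  have habs : |(√2 - 1) ^ n| ≤ 1 := by
    rw [abs_pow, abs_of_nonneg (by linarith)]
    exact pow_le_one₀ (by linarith) (by linarith)
  obtain ⟨w, hw⟩ := terminates h (e := (⟨-1, 1⟩ ^ n, 0)) (by rwa [heval])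
    (by rw [heval]; linarith)
  have h₁ := evalAt_walk h.2 w (⟨-1, 1⟩ ^ n, 0)
  have h₂ := evalAt_walk h.inv_sq w (⟨-1, 1⟩ ^ n, 0)
  rw [hw, heval] at h₁ h₂
  simp only [evalAt, Prod.fst_zero, Prod.snd_zero, map_zero, zero_mul, add_zero] at h₁ h₂
  refine ⟨w.reverse.map (-·) ++ [0], w, ?_, h₁.symm⟩
  have h₃ : w.reverse.map (-·) ++ [0] = (w.reverse ++ [0]).map (-·) := by simp
  have h₄ : wordEval β⁻¹ w = -(β⁻¹ ^ w.length * (√2 - 1) ^ n) :=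
    eq_neg_of_add_eq_zero_right h₂.symm
  rw [h₃, wordEval_map_neg, wordEval_reverse h.pos.ne', h₄, inv_pow]
  have := pow_ne_zero w.length h.pos.ne'
  field_simp

end SalemRelation

/-- For the Salem number `β`, the unique real root greater than `1` of
`X⁴ - 2X³ + X² - 2X + 1`, the relation language `L(β, {0, 1})` is not regular: the
semigroup generated by `x ↦ βx` and `x ↦ βx + 1` is not strongly automatic. -/
theorem salem_relLang_not_isRegular (β : ℝ) (hβ : 1 < β)
    (hroot : β ^ 4 - 2 * β ^ 3 + β ^ 2 - 2 * β + 1 = 0) :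
    ¬ (relLang β ({0, 1} : Finset ℝ)).IsRegular := by
  intro hreg
  obtain ⟨σ, _, M, hM⟩ := hreg
  have h := SalemRelation.isSalem_of_root hβ hroot
  choose u w hu hw using h.exists_words
  obtain ⟨m, n, hmn, heq⟩ := Finite.exists_ne_map_eq_of_infinite
    fun n => M.eval ((u n).map SalemRelation.toPair)
  have hmem (i : ℕ) : (u i ++ w n).map SalemRelation.toPair ∈ M.accepts ↔
      β ^ (w n).length * (√2 - 1) ^ i + SalemRelation.wordEval β (w n) = 0 := by
    rw [hM, SalemRelation.toPair_mem_relLang_iff, SalemRelation.wordEval_append, hu]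
  have hiff : (u m ++ w n).map SalemRelation.toPair ∈ M.accepts ↔
      (u n ++ w n).map SalemRelation.toPair ∈ M.accepts := by
    simp only [DFA.mem_accepts, DFA.eval, DFA.evalFrom_of_append, List.map_append] at heq ⊢
    rw [heq]
  have hm := (hmem m).1 (hiff.2 ((hmem n).2 (hw n)))
  have hpow : (√2 - 1) ^ m = (√2 - 1) ^ n :=
    mul_left_cancel₀ (pow_ne_zero (w n).length h.pos.ne') (by linarith [hw n])
  obtain ⟨h₁, h₂⟩ := SalemRelation.sqrt_two_sharp_bounds
  exact hmn (pow_right_injective₀ (by linarith) (by linarith) hpow)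
end

section
/- Let G be a group generated as a semigroup by a finite subset Σ ⊆ G (every element of G is a nonempty product of elements of Σ). Then the relation language of (G, Σ) is regular if and only if G is finite. In other words, a group is strongly automatic if and only if it is finite. -/
/-- The relation language of a finite subset `S` of a group `G`, over the alphabet
`S × (S ∪ {1})`: words `(u₁,v₁) ⋯ (uₙ,vₙ)` with `uᵢ ∈ S`, `vᵢ ∈ S ∪ {1}` and
`u₁ ⋯ uₙ = v₁ ⋯ vₙ` in `G`. -/
def grpRelLang (G : Type*) [Group G] (S : Finset G) :
    Language (↥(S : Set G) × ↥(insert (1 : G) (S : Set G))) :=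
  { w | (w.map fun p => (p.1.1 : G)).prod = (w.map fun p => (p.2.1 : G)).prod }

theorem mem_grpRelLang_leftQuotient {G : Type*} [Group G] {S : Finset G}
    (x y : List (↥(S : Set G) × ↥(insert (1 : G) (S : Set G)))) :
    y ∈ (grpRelLang G S).leftQuotient x ↔
      (x.map fun p => (p.1.1 : G)).prod * (y.map fun p => (p.1.1 : G)).prod =
        (x.map fun p => (p.2.1 : G)).prod * (y.map fun p => (p.2.1 : G)).prod := by
  rw [Language.mem_leftQuotient, ← List.prod_append, ← List.prod_append, ← List.map_append,
    ← List.map_append]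
  rfl

/-- Every product of generators is the first coordinate of a word whose second coordinate
is trivial. -/
theorem exists_word_fst_eq {G : Type*} [Group G] {S : Finset G} (l : List G)
    (hl : ∀ x ∈ l, x ∈ S) :
    ∃ w : List (↥(S : Set G) × ↥(insert (1 : G) (S : Set G))),
      (w.map fun p => (p.1.1 : G)).prod = l.prod ∧ (w.map fun p => (p.2.1 : G)).prod = 1 := by
  induction l with
  | nil => exact ⟨[], by simp⟩
  | cons s t ih =>
    obtain ⟨w, hw₁, hw₂⟩ := ih fun x hx => hl x (List.mem_cons_of_mem s hx)
    refine ⟨(⟨s, hl s List.mem_cons_self⟩, ⟨1, Set.mem_insert _ _⟩) :: w, ?_, ?_⟩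
    · rw [List.map_cons, List.prod_cons, List.prod_cons, hw₁]
    · rw [List.map_cons, List.prod_cons, hw₂, mul_one]

/-- If the identity is a nonempty product of generators, every product of generators is the
second coordinate of a word whose first coordinate is trivial. -/
theorem exists_word_snd_eq {G : Type*} [Group G] {S : Finset G}
    (hone : ∃ l : List G, l ≠ [] ∧ (∀ x ∈ l, x ∈ S) ∧ l.prod = 1) (l : List G)
    (hl : ∀ x ∈ l, x ∈ S) :
    ∃ w : List (↥(S : Set G) × ↥(insert (1 : G) (S : Set G))),
      (w.map fun p => (p.1.1 : G)).prod = 1 ∧ (w.map fun p => (p.2.1 : G)).prod = l.prod := by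
  obtain ⟨k, hk, hkS, hk1⟩ := hone
  obtain ⟨c, r, rfl⟩ := List.exists_cons_of_ne_nil hk
  obtain ⟨v, hv₁, hv₂⟩ := exists_word_fst_eq r fun x hx => hkS x (List.mem_cons_of_mem c hx)
  induction l with
  | nil => exact ⟨[], by simp⟩
  | cons s t ih =>
    obtain ⟨w, hw₁, hw₂⟩ := ih fun x hx => hl x (List.mem_cons_of_mem s hx)
    refine ⟨(⟨c, hkS c List.mem_cons_self⟩,
      ⟨s, Set.mem_insert_of_mem _ (hl s List.mem_cons_self)⟩) :: (v ++ w), ?_, ?_⟩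
    · rw [List.prod_cons] at hk1
      simp only [List.map_cons, List.map_append, List.prod_cons, List.prod_append, hv₁, hw₁,
        mul_one, hk1]
    · simp only [List.map_cons, List.map_append, List.prod_cons, List.prod_append, hv₂, hw₂,
        one_mul]

/-- If a group `G` is generated as a semigroup by a finite subset `S` (every element is
a nonempty product of elements of `S`), then the relation language of `(G, S)` is
regular iff `G` is finite: a group is strongly automatic iff it is finite. -/
theorem grpRelLang_isRegular_iff_finite (G : Type*) [Group G] (S : Finset G)
    (hgen : ∀ g : G, ∃ l : List G, l ≠ [] ∧ (∀ x ∈ l, x ∈ S) ∧ l.prod = g) :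
    (grpRelLang G S).IsRegular ↔ Finite G := by
  rw [Language.isRegular_iff_finite_range_leftQuotient]
  constructor
  · intro hfin
    have hfst (g : G) : ∃ w : List (↥(S : Set G) × ↥(insert (1 : G) (S : Set G))),
        (w.map fun p => (p.1.1 : G)).prod = g ∧ (w.map fun p => (p.2.1 : G)).prod = 1 := by
      obtain ⟨l, -, hl, rfl⟩ := hgen g
      exact exists_word_fst_eq l hl
    have hsnd (g : G) : ∃ w : List (↥(S : Set G) × ↥(insert (1 : G) (S : Set G))),
        (w.map fun p => (p.1.1 : G)).prod = 1 ∧ (w.map fun p => (p.2.1 : G)).prod = g := by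
      obtain ⟨l, -, hl, rfl⟩ := hgen g
      exact exists_word_snd_eq (hgen 1) l hl
    choose x hx₁ hx₂ using hfst
    choose y hy₁ hy₂ using hsnd
    have hmem (g h : G) : y h ∈ (grpRelLang G S).leftQuotient (x g) ↔ g = h := by
      rw [mem_grpRelLang_leftQuotient, hx₁, hx₂, hy₁, hy₂, mul_one, one_mul]
    have := hfin.to_subtype
    refine Finite.of_injective (fun g => (⟨_, Set.mem_range_self (x g)⟩ :
      Set.range (grpRelLang G S).leftQuotient)) fun g h hgh => ?_
    have hq : (grpRelLang G S).leftQuotient (x g) = (grpRelLang G S).leftQuotient (x h) :=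
      congrArg Subtype.val hgh
    exact ((hmem h g).mp (hq ▸ (hmem g g).mpr rfl)).symm
  · intro _
    refine (Set.finite_range fun q : G × G =>
      ({y | q.1 * (y.map fun p => (p.1.1 : G)).prod = q.2 * (y.map fun p => (p.2.1 : G)).prod} :
        Language (↥(S : Set G) × ↥(insert (1 : G) (S : Set G))))).subset ?_
    rintro _ ⟨x, rfl⟩
    refine ⟨((x.map fun p => (p.1.1 : G)).prod, (x.map fun p => (p.2.1 : G)).prod), ?_⟩
    ext y
    exact (mem_grpRelLang_leftQuotient x y).symm
end

section
/- Suppose the sub-semigroup Γ of the group G is strongly automatic for the finite generating set Σ, and suppose there exist words u₁⋯uₙ and v₁⋯vₘ with all letters in Σ, n ≠ m, and u₁⋯uₙ = v₁⋯vₘ in G. Then Γ is a finite subgroup of G: Γ is finite, contains the identity e, and contains the inverse of each of its elements. -/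
/-- The sub-semigroup of `G` generated by `S`: all nonempty products of elements of `S`. -/
def genSemigroup {G : Type*} [Group G] (S : Finset G) : Set G :=
  { g | ∃ l : List G, l ≠ [] ∧ (∀ x ∈ l, x ∈ S) ∧ l.prod = g }

/-- If two words over `S` of distinct lengths represent the same element, then any word `w` over `S`
can be prepended to the first component of some padded pair of words, to give a relation. -/
theorem exists_completion {G : Type*} [Group G] {S : Finset G} {a b : List ↥(S : Set G)}
    (hlen : b.length < a.length)
    (hab : (a.map Subtype.val).prod = (b.map Subtype.val).prod)
    (w : List ↥(S : Set G)) :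
    ∃ y : List (↥(S : Set G) × ↥(insert (1 : G) (S : Set G))),
      (w.map Subtype.val).prod * (y.map fun p => (p.1.1 : G)).prod =
        (y.map fun p => (p.2.1 : G)).prod := by
  let ι : ↥(S : Set G) → ↥(insert (1 : G) (S : Set G)) := fun x => ⟨x.1, Or.inr x.2⟩
  let o : ↥(insert (1 : G) (S : Set G)) := ⟨1, Or.inl rfl⟩
  let k := w.length
  let A := (List.replicate k a).flatten
  let B := w ++ (List.replicate k b).flatten
  have hB : B.length ≤ A.length := by
    have h : k * (b.length + 1) ≤ k * a.length := Nat.mul_le_mul_left _ hlen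
    have hA : A.length = k * a.length := by simp [A]
    have hB : B.length = k + k * b.length := by simp [B, k]
    rw [hA, hB]
    linarith
  let C := B.map ι ++ List.replicate (A.length - B.length) o
  have hC : A.length = C.length := by
    simp only [C, List.length_append, List.length_map, List.length_replicate]
    omega
  refine ⟨A.zip C, ?_⟩
  have h₁ : ((A.zip C).map fun p => (p.1.1 : G)) = A.map Subtype.val := by
    conv_rhs => rw [← List.map_fst_zip hC.le, List.map_map]
    rfl
  have h₂ : ((A.zip C).map fun p => (p.2.1 : G)) = C.map Subtype.val := by
    conv_rhs => rw [← List.map_snd_zip hC.ge, List.map_map]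
    rfl
  rw [h₁, h₂]
  simpa [A, B, C, ι, o, Function.comp_def, List.map_flatten, List.prod_flatten] using
    congrArg (· ^ k) hab

/-- Under the same hypothesis, regularity of the relation language forces only finitely many elements
to be represented by words over `S`. -/
theorem finite_genSemigroup {G : Type*} [Group G] {S : Finset G}
    (hreg : (grpRelLang G S).IsRegular) {a b : List ↥(S : Set G)}
    (hlen : b.length < a.length)
    (hab : (a.map Subtype.val).prod = (b.map Subtype.val).prod) :
    (genSemigroup S).Finite := by
  let f : List ↥(S : Set G) → G := fun w => (w.map Subtype.val).prod
  let o : ↥(insert (1 : G) (S : Set G)) := ⟨1, Or.inl rfl⟩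
  let q : List ↥(S : Set G) →
      Language (↥(S : Set G) × ↥(insert (1 : G) (S : Set G))) :=
    fun w => (grpRelLang G S).leftQuotient (w.map fun x => (x, o))
  have hq : ∀ w y, y ∈ q w ↔
      f w * (y.map fun p => (p.1.1 : G)).prod = (y.map fun p => (p.2.1 : G)).prod := by
    intro w y
    change (List.map _ (_ ++ _)).prod = (List.map _ (_ ++ _)).prod ↔ _
    simp [f, o, Function.comp_def]
  have hfq : f.FactorsThrough q := by
    intro w w' h
    obtain ⟨y, hy⟩ := exists_completion hlen hab w
    have hy' := (hq w' y).1 (h ▸ (hq w y).2 hy)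
    exact mul_right_cancel (hy.trans hy'.symm)
  have hfin : (Set.range q).Finite :=
    (Language.isRegular_iff_finite_range_leftQuotient.1 hreg).subset
      (by rintro _ ⟨w, rfl⟩; exact ⟨_, rfl⟩)
  refine (hfin.image (Function.extend q f fun _ => 1)).subset ?_
  rintro g ⟨l, -, hl, rfl⟩
  lift l to List ↥(S : Set G) using hl
  exact ⟨q l, ⟨l, rfl⟩, hfq.extend_apply _ l⟩

theorem mul_mem_genSemigroup {G : Type*} [Group G] {S : Finset G} {g h : G}
    (hg : g ∈ genSemigroup S) (hh : h ∈ genSemigroup S) : g * h ∈ genSemigroup S := by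
  obtain ⟨l, hl, hlS, rfl⟩ := hg
  obtain ⟨m, -, hmS, rfl⟩ := hh
  refine ⟨l ++ m, by simp [hl], fun x hx => ?_, List.prod_append⟩
  exact (List.mem_append.1 hx).elim (hlS x) (hmS x)

theorem pow_mem_genSemigroup {G : Type*} [Group G] {S : Finset G} {g : G}
    (hg : g ∈ genSemigroup S) {n : ℕ} (hn : 0 < n) : g ^ n ∈ genSemigroup S := by
  induction n, hn using Nat.le_induction with
  | base => simpa using hg
  | succ n _ ih => exact pow_succ g n ▸ mul_mem_genSemigroup ih hg

/-- A finite sub-semigroup of a group contains the identity and the inverses of its elements. -/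
theorem one_mem_and_inv_mem_genSemigroup {G : Type*} [Group G] {S : Finset G}
    (hfin : (genSemigroup S).Finite) {g : G} (hg : g ∈ genSemigroup S) :
    1 ∈ genSemigroup S ∧ g⁻¹ ∈ genSemigroup S := by
  have hord : IsOfFinOrder g := by
    by_contra h
    have hinj := injective_pow_iff_not_isOfFinOrder.2 h
    exact Set.infinite_of_injective_forall_mem (f := fun n : ℕ => g ^ (n + 1))
      (fun m n hmn => Nat.succ_injective (hinj hmn))
      (fun n => pow_mem_genSemigroup hg n.succ_pos) hfin
  obtain ⟨k, hk, hgk⟩ := isOfFinOrder_iff_pow_eq_one.1 hord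
  refine ⟨hgk ▸ pow_mem_genSemigroup hg hk, ?_⟩
  have h : g⁻¹ = g ^ (2 * k - 1) := by
    rw [inv_eq_iff_mul_eq_one, ← pow_succ', Nat.sub_add_cancel (by omega), mul_comm, pow_mul, hgk,
      one_pow]
  exact h ▸ pow_mem_genSemigroup hg (by omega)

/-- If the sub-semigroup `Γ` of `G` generated by the finite set `S` is strongly
automatic for `S` and there is a relation `u₁ ⋯ uₙ = v₁ ⋯ vₘ` in `G` between two
nonempty words over `S` of distinct lengths, then `Γ` is a finite subgroup of `G`:
it is finite, contains the identity, and contains the inverse of each of its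
elements. -/
theorem finite_subgroup_of_isRegular_of_length_mixing (G : Type*) [Group G]
    (S : Finset G) (hreg : (grpRelLang G S).IsRegular)
    (hmix : ∃ u v : List G, u ≠ [] ∧ v ≠ [] ∧ (∀ x ∈ u, x ∈ S) ∧ (∀ x ∈ v, x ∈ S) ∧
      u.length ≠ v.length ∧ u.prod = v.prod) :
    (genSemigroup S).Finite ∧ (1 : G) ∈ genSemigroup S ∧
      ∀ g ∈ genSemigroup S, g⁻¹ ∈ genSemigroup S := by
  have hfin : (genSemigroup S).Finite := by
    obtain ⟨u, v, -, -, hu, hv, hne, huv⟩ := hmix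
    lift u to List ↥(S : Set G) using hu
    lift v to List ↥(S : Set G) using hv
    rw [List.length_map, List.length_map] at hne
    rcases hne.lt_or_gt with h | h
    · exact finite_genSemigroup hreg h huv.symm
    · exact finite_genSemigroup hreg h huv
  obtain ⟨u, -, hu, -, huS, -⟩ := hmix
  exact ⟨hfin, (one_mem_and_inv_mem_genSemigroup hfin ⟨u, hu, huS, rfl⟩).1,
    fun g hg => (one_mem_and_inv_mem_genSemigroup hfin hg).2⟩
end

section
/- If the sub-semigroup Γ of the group G is strongly automatic for the finite generating set Σ, then there exists a regular language L_red over the alphabet Σ such that the evaluation map sending a word w₁⋯wₙ ∈ L_red to the product w₁⋯wₙ ∈ G is a bijection from L_red onto Γ. (Γ admits a regular cross-section of unique representative words; this is the reduced-word part of an automatic structure, so every strongly automatic semigroup is automatic.) -/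
/-- The image of a regular language under a letter-to-letter map is regular. -/
theorem Language.IsRegular.image_map {α β : Type*} {L : Language α} (hL : L.IsRegular)
    (f : α → β) : Language.IsRegular ({ w | ∃ x ∈ L, x.map f = w } : Language β) := by
  obtain ⟨σ, _, M, rfl⟩ := hL
  let N : NFA β σ := ⟨fun s b => { t | ∃ a, f a = b ∧ t = M.step s a }, {M.start}, M.accept⟩
  have key : ∀ (w : List β) (T : Set σ) (t : σ),
      t ∈ N.evalFrom T w ↔ ∃ s ∈ T, ∃ x : List α, x.map f = w ∧ M.evalFrom s x = t := by
    intro w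
    induction w with
    | nil => intro T t; simp
    | cons b w ih =>
      intro T t
      rw [NFA.evalFrom_cons, ih]
      constructor
      · rintro ⟨s, hs, x, rfl, rfl⟩
        obtain ⟨s', hs', a, rfl, rfl⟩ := NFA.mem_stepSet.1 hs
        exact ⟨s', hs', a :: x, rfl, rfl⟩
      · rintro ⟨s, hs, x, hx, rfl⟩
        obtain ⟨a, x, rfl, rfl, rfl⟩ := List.map_eq_cons_iff.1 hx
        exact ⟨M.step s a, NFA.mem_stepSet.2 ⟨s, hs, a, rfl, rfl⟩, x, rfl, rfl⟩
  refine Language.isRegular_iff.2 ⟨Set σ, inferInstance, N.toDFA, ?_⟩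
  rw [NFA.toDFA_correct]
  ext w
  rw [NFA.mem_accepts]
  constructor
  · rintro ⟨t, ht, h⟩
    obtain ⟨s, rfl, x, hx, rfl⟩ := (key _ _ _).1 h
    exact ⟨x, ht, hx⟩
  · rintro ⟨x, hx, rfl⟩
    exact ⟨_, hx, (key _ _ _).2 ⟨_, rfl, x, rfl, rfl⟩⟩

theorem Language.isRegular_singleton {α : Type*} (u : List α) :
    Language.IsRegular ({u} : Language α) := by
  refine .of_finite_range_leftQuotient ?_
  refine ((Set.finite_singleton (∅ : Set (List α))).union
    ((List.finite_toSet u.tails).image fun v => ({v} : Set (List α)))).subset ?_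
  rintro _ ⟨x, rfl⟩
  by_cases h : ∃ v, x ++ v = u
  · obtain ⟨v, rfl⟩ := h
    refine Or.inr ⟨v, ?_, ?_⟩
    · simp [List.mem_tails]
    · ext y
      change y = v ↔ x ++ y = x ++ v
      simp
  · refine Or.inl ?_
    ext y
    exact iff_of_false (fun hy => h ⟨y, hy⟩) (fun hy => hy)

/-- The words in which some letter satisfies `p` form a regular language. -/
theorem Language.isRegular_exists_mem {α : Type*} (p : α → Prop) :
    Language.IsRegular ({ w | ∃ a ∈ w, p a } : Language α) := by
  refine .of_finite_range_leftQuotient ?_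
  refine (Set.toFinite {(Set.univ : Set (List α)), { w | ∃ a ∈ w, p a }}).subset ?_
  rintro _ ⟨x, rfl⟩
  by_cases h : ∃ a ∈ x, p a
  · refine Or.inl ?_
    ext y
    obtain ⟨a, ha, hp⟩ := h
    exact iff_of_true ⟨a, List.mem_append_left _ ha, hp⟩ trivial
  · refine Or.inr ?_
    ext y
    change (∃ a ∈ x ++ y, p a) ↔ ∃ a ∈ y, p a
    constructor
    · rintro ⟨a, ha, hp⟩
      rcases List.mem_append.1 ha with ha | ha
      · exact (h ⟨a, ha, hp⟩).elim
      · exact ⟨a, ha, hp⟩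
    · rintro ⟨a, ha, hp⟩
      exact ⟨a, List.mem_append_right _ ha, hp⟩

/-- Lexicographic comparison of two letterwise images of a word is regular. -/
theorem Language.isRegular_lex_map {α β : Type*} (r : β → β → Prop) (f g : α → β) :
    Language.IsRegular ({ w | List.Lex r (w.map f) (w.map g) } : Language α) := by
  refine .of_finite_range_leftQuotient ?_
  refine (Set.toFinite {(Set.univ : Set (List α)), ∅,
    { w | List.Lex r (w.map f) (w.map g) }}).subset ?_
  rintro _ ⟨x, rfl⟩
  induction x with
  | nil => exact Or.inr (Or.inr rfl)
  | cons a x ih =>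
    have key : ∀ y : List α, List.Lex r ((a :: x ++ y).map f) ((a :: x ++ y).map g) ↔
        r (f a) (g a) ∨ f a = g a ∧ List.Lex r ((x ++ y).map f) ((x ++ y).map g) := fun y => by
      rw [List.cons_append, List.map_cons, List.map_cons, List.cons_lex_cons_iff]
    by_cases hr : r (f a) (g a)
    · refine Or.inl ?_
      ext y
      exact iff_of_true ((key y).2 (Or.inl hr)) trivial
    by_cases he : f a = g a
    · refine (congrArg (· ∈ _) (Set.ext fun y => (key y).trans ?_)).mpr ih
      exact ⟨fun h => (h.resolve_left hr).2, fun h => Or.inr ⟨he, h⟩⟩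
    · refine Or.inr (Or.inl ?_)
      ext y
      refine iff_of_false (fun h => ?_) (fun h => h)
      rcases (key y).1 h with h | h
      · exact hr h
      · exact he h.1

/-- Some word over `S` is shortlex-smaller than `w` with the same value iff `w` is related to
a word of the same length over `S ∪ {1}` that contains `1` or is lexicographically smaller. -/
theorem exists_shortlex_iff_exists_mem_grpRelLang {G : Type*} [Group G] (S : Finset G)
    (r : G → G → Prop) (w : List (↥(S : Set G))) :
    (∃ v : List (↥(S : Set G)),
      (v.map Subtype.val).prod = (w.map Subtype.val).prod ∧
        List.Shortlex r (v.map Subtype.val) (w.map Subtype.val)) ↔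
    ∃ x ∈ grpRelLang G S, ((∃ p ∈ x, (p.2 : G) = 1) ∨
      List.Lex r (x.map fun p => (p.2 : G)) (x.map fun p => (p.1 : G))) ∧
        x.map Prod.fst = w := by
  classical
  constructor
  · rintro ⟨v, hv, hlt⟩
    have hlen : v.length ≤ w.length := by
      rcases List.shortlex_def.1 hlt with h | h
      · simpa using h.le
      · simpa using h.1.le
    let i : ↥(S : Set G) → ↥(insert (1 : G) (S : Set G)) := fun x => ⟨x, Or.inr x.2⟩
    let z := v.map i ++ List.replicate (w.length - v.length) ⟨1, Or.inl rfl⟩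
    have hz : w.length = z.length := by simp [z, hlen]
    have h1 : (w.zip z).map Prod.fst = w := List.map_fst_zip hz.le
    have h2 : (w.zip z).map Prod.snd = z := List.map_snd_zip hz.ge
    have h1' : (w.zip z).map (fun p => (p.1 : G)) = w.map Subtype.val := by
      conv_rhs => rw [← h1]
      simp
    have h2' : (w.zip z).map (fun p => (p.2 : G)) = z.map Subtype.val := by
      conv_rhs => rw [← h2]
      simp
    refine ⟨w.zip z, ?_, ?_, h1⟩
    · change ((w.zip z).map fun p => (p.1 : G)).prod = ((w.zip z).map fun p => (p.2 : G)).prod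
      rw [h1', h2', ← hv]
      simp [z, i, Function.comp_def]
    · rcases List.shortlex_def.1 hlt with h | ⟨h, hl⟩
      · left
        have hlt' : v.length < w.length := by simpa using h
        have hm : (1 : G) ∈ (w.zip z).map (fun p => (p.2 : G)) := by
          rw [h2']
          refine List.mem_map.2 ⟨⟨1, Or.inl rfl⟩, ?_, rfl⟩
          exact List.mem_append_right _ (List.mem_replicate.2 ⟨by omega, rfl⟩)
        exact List.mem_map.1 hm
      · right
        have h' : v.length = w.length := by simpa using h
        rw [h1', h2']
        simpa [z, i, h', Function.comp_def] using hl
  · rintro ⟨x, hx, hor, rfl⟩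
    replace hx : (x.map fun p => (p.1 : G)).prod = (x.map fun p => (p.2 : G)).prod := hx
    let l := (x.map fun p => (p.2 : G)).filter (· ≠ 1)
    have hl : ∀ g ∈ l, g ∈ (S : Set G) := by
      intro g hg
      obtain ⟨hg, h1⟩ := List.mem_filter.1 hg
      obtain ⟨p, -, rfl⟩ := List.mem_map.1 hg
      exact p.2.2.resolve_left (by simpa using h1)
    have hprod : l.prod = (x.map fun p => (p.2 : G)).prod := by
      have : ∀ m : List G, (m.filter (· ≠ 1)).prod = m.prod := by
        intro m
        induction m with
        | nil => rfl
        | cons a m ih =>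
          by_cases ha : a = 1
          · simpa [ha] using ih
          · simpa [ha] using ih
      exact this _
    lift l to List (↥(S : Set G)) using hl with v hv
    refine ⟨v, ?_, ?_⟩
    · rw [List.map_map]
      exact hprod.trans hx.symm
    · by_cases h1 : ∃ p ∈ x, (p.2 : G) = 1
      · apply List.Shortlex.of_length_lt
        rw [hv]
        obtain ⟨p, hp, hp1⟩ := h1
        have : ((x.map fun p => (p.2 : G)).filter (· ≠ 1)).length <
            (x.map fun p => (p.2 : G)).length :=
          List.length_filter_lt_length_iff_exists.2
            ⟨1, List.mem_map.2 ⟨p, hp, hp1⟩, by simp⟩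
        simpa [l] using this
      · have he : (x.map fun p => (p.2 : G)).filter (· ≠ 1) = x.map fun p => (p.2 : G) := by
          rw [List.filter_eq_self]
          intro g hg
          obtain ⟨p, hp, rfl⟩ := List.mem_map.1 hg
          simpa using fun h => h1 ⟨p, hp, h⟩
        rw [hv, show l = _ from he, List.map_map]
        exact List.Shortlex.of_lex (by simp) (hor.resolve_left h1)

/-- The words over `S` that are shortlex-least among the words of the same value. -/
def shortlexLeast {G : Type*} [Group G] (S : Finset G) (r : G → G → Prop) :
    Language (↥(S : Set G)) :=
  { w | ¬ ∃ v : List (↥(S : Set G)),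
      (v.map Subtype.val).prod = (w.map Subtype.val).prod ∧
        List.Shortlex r (v.map Subtype.val) (w.map Subtype.val) }

theorem isRegular_shortlexLeast {G : Type*} [Group G] (S : Finset G) (r : G → G → Prop)
    (hreg : (grpRelLang G S).IsRegular) : (shortlexLeast S r).IsRegular := by
  refine Language.IsRegular.of_compl ?_
  have h := (hreg.inf ((Language.isRegular_exists_mem fun p => (p.2 : G) = 1).add
    (Language.isRegular_lex_map r (fun p => (p.2 : G)) fun p => (p.1 : G)))).image_map
      Prod.fst
  refine (congrArg Language.IsRegular (Set.ext fun w => ?_)).mpr h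
  refine not_not.trans ((exists_shortlex_iff_exists_mem_grpRelLang S r w).trans ?_)
  constructor
  · rintro ⟨x, hx, h, rfl⟩
    exact ⟨x, ⟨hx, h⟩, rfl⟩
  · rintro ⟨x, ⟨hx, h⟩, rfl⟩
    exact ⟨x, hx, h, rfl⟩

theorem injOn_shortlexLeast {G : Type*} [Group G] (S : Finset G) (r : G → G → Prop)
    [Std.Trichotomous r] :
    Set.InjOn (fun w : List (↥(S : Set G)) => (w.map Subtype.val).prod)
      (shortlexLeast S r) := by
  intro v hv w hw hvw
  refine List.map_injective_iff.2 Subtype.val_injective ?_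
  exact Std.Trichotomous.trichotomous (r := List.Shortlex r) _ _
    (fun h => hw ⟨v, hvw, h⟩) (fun h => hv ⟨w, hvw.symm, h⟩)

theorem exists_mem_shortlexLeast {G : Type*} [Group G] (S : Finset G) {r : G → G → Prop}
    (hr : WellFounded r) (w : List (↥(S : Set G))) :
    ∃ v ∈ shortlexLeast S r,
      (v.map Subtype.val).prod = (w.map Subtype.val).prod := by
  have wf := InvImage.wf (List.map (Subtype.val : ↥(S : Set G) → G))
    (List.Shortlex.wf hr)
  obtain ⟨v, hv, hmin⟩ := wf.has_min
    { v | (v.map Subtype.val).prod = (w.map Subtype.val).prod } ⟨w, rfl⟩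
  exact ⟨v, fun ⟨u, hu, hlt⟩ => hmin u (hu.trans hv) hlt, hv⟩

/-- If the sub-semigroup `Γ` of `G` generated by the finite set `S` is strongly
automatic for `S`, then there is a regular language `Lred` of words over `S` such
that evaluation (taking products in `G`) is a bijection from `Lred` onto `Γ`:
`Γ` has a regular cross-section of unique representative words. -/
theorem exists_regular_reduced_words (G : Type*) [Group G] (S : Finset G)
    (hreg : (grpRelLang G S).IsRegular) :
    ∃ Lred : Language (↥(S : Set G)), Lred.IsRegular ∧
      Set.BijOn (fun w : List (↥(S : Set G)) => (w.map fun x => (x : G)).prod)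
        Lred (genSemigroup S) := by
  have hev : (fun w : List (↥(S : Set G)) => (w.map fun x => (x : G)).prod) =
      fun w => (w.map Subtype.val).prod := by
    funext w
    congr 1
    simp [List.flatMap_singleton']
  rw [hev]
  classical
  let r : G → G → Prop := WellOrderingRel
  have hnil : [] ∈ shortlexLeast S r := fun ⟨v, _, hv⟩ => List.not_shortlex_nil_right hv
  have hval : ∀ w : List (↥(S : Set G)), w ≠ [] →
      (w.map Subtype.val).prod ∈ genSemigroup S := by
    refine fun w hw => ⟨w.map Subtype.val, List.map_eq_nil_iff.not.2 hw, ?_, rfl⟩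
    intro g hg
    obtain ⟨a, -, rfl⟩ := List.mem_map.1 hg
    exact a.2
  have hword : ∀ g ∈ genSemigroup S, ∃ w : List (↥(S : Set G)), w ≠ [] ∧
      (w.map Subtype.val).prod = g := by
    rintro g ⟨l, hne, hl, rfl⟩
    lift l to List (↥(S : Set G)) using hl
    exact ⟨l, fun h => hne (List.map_eq_nil_iff.2 h), rfl⟩
  have hreg' : (shortlexLeast S r ⊓ ({[]} : Language (↥(S : Set G)))ᶜ).IsRegular :=
    (isRegular_shortlexLeast S r hreg).inf (Language.isRegular_singleton []).compl
  have hinj : Set.InjOn (fun w : List (↥(S : Set G)) => (w.map Subtype.val).prod)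
      (shortlexLeast S r ⊓ ({[]} : Language (↥(S : Set G)))ᶜ) :=
    (injOn_shortlexLeast S r).mono fun _ h => h.1
  have hone : ∀ w ∈ shortlexLeast S r, (w.map Subtype.val).prod = 1 → w = [] :=
    fun w hw h => injOn_shortlexLeast S r hw hnil (by simpa using h)
  by_cases h1 : (1 : G) ∈ genSemigroup S
  · obtain ⟨u, hu, hu1⟩ := hword 1 h1
    refine ⟨_, hreg'.add (Language.isRegular_singleton u), ?_, ?_, ?_⟩
    · rintro w (hw | rfl)
      · exact hval w hw.2
      · exact hval w hu
    · rintro v (hv | rfl) w (hw | rfl) hvw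
      · exact hinj hv hw hvw
      · exact (hv.2 (hone v hv.1 (hvw.trans hu1))).elim
      · exact (hw.2 (hone w hw.1 (hvw.symm.trans hu1))).elim
      · rfl
    · intro g hg
      by_cases hg1 : g = 1
      · exact ⟨u, Or.inr rfl, hu1.trans hg1.symm⟩
      · obtain ⟨w, -, rfl⟩ := hword g hg
        obtain ⟨v, hv, hvw⟩ := exists_mem_shortlexLeast S (r := r) WellOrderingRel.isWellOrder.wf w
        refine ⟨v, Or.inl ⟨hv, ?_⟩, hvw⟩
        rintro rfl
        exact hg1 (by simpa using hvw.symm)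
  · refine ⟨_, hreg', fun w hw => hval w hw.2, hinj, ?_⟩
    intro g hg
    obtain ⟨w, -, rfl⟩ := hword g hg
    obtain ⟨v, hv, hvw⟩ := exists_mem_shortlexLeast S (r := r) WellOrderingRel.isWellOrder.wf w
    refine ⟨v, ⟨hv, ?_⟩, hvw⟩
    rintro rfl
    refine h1 ?_
    have h : (1 : G) = (w.map Subtype.val).prod := by simpa using hvw
    rwa [h]
end

section
/- Let M be a nondeterministic finite automaton over a finite alphabet, with finitely many states, satisfying: (i) M is trim, i.e. every state q lies on some accepting computation (there is a word labelling a path from a start state to q and a word labelling a path from q to an accept state); (ii) M is deterministic: it has at most one start state, and for every state q and letter a there is at most one state reachable from q by a; (iii) the transpose of M is deterministic: M has at most one accept state, and for every state q and letter a there is at most one state p such that q is reachable from p by a. Then M is a minimal automaton for its language: every deterministic finite automaton recognizing the same language has at least as many states as M. -/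
namespace NFA

variable {α σ : Type*} {M : NFA α σ}

/-- A deterministic automaton reaches at most one state from a set of at most one state. -/
theorem subsingleton_evalFrom (hdet : ∀ (q : σ) (a : α), (M.step q a).Subsingleton)
    {S : Set σ} (hS : S.Subsingleton) (x : List α) : (M.evalFrom S x).Subsingleton := by
  induction x generalizing S with
  | nil => exact hS
  | cons a x ih =>
    rw [evalFrom_cons]
    refine ih fun p hp q hq => ?_
    obtain ⟨s, hs, hp⟩ := mem_stepSet.1 hp
    obtain ⟨t, ht, hq⟩ := mem_stepSet.1 hq
    obtain rfl := hS hs ht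
    exact hdet s a hp hq

/-- In a co-deterministic automaton, a state is reached by a given word from at most one state. -/
theorem eq_of_mem_evalFrom_singleton
    (hcodet : ∀ (q : σ) (a : α), {p : σ | q ∈ M.step p a}.Subsingleton)
    {p q f : σ} {x : List α} (hp : f ∈ M.evalFrom {p} x) (hq : f ∈ M.evalFrom {q} x) :
    p = q := by
  induction x generalizing p q with
  | nil => exact (Set.mem_singleton_iff.1 hp).symm.trans (Set.mem_singleton_iff.1 hq)
  | cons a x ih =>
    rw [evalFrom_cons, stepSet_singleton, mem_evalFrom_iff_exists] at hp hq
    obtain ⟨s, hs, hp⟩ := hp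
    obtain ⟨t, ht, hq⟩ := hq
    obtain rfl := ih hp hq
    exact hcodet s a hs ht

end NFA


/-- An NFA with finitely many states which is trim (every state lies on some accepting
computation), deterministic (at most one start state, at most one successor per state
and letter), and co-deterministic (its transpose is deterministic: at most one accept
state, at most one predecessor per state and letter) is minimal: any DFA with finitely
many states recognizing the same language has at least as many states. -/
theorem nfa_minimal_of_trim_det_codet {α : Type} [Fintype α] {σ : Type} [Fintype σ]
    (M : NFA α σ)
    (htrim : ∀ q : σ, ∃ u v : List α, q ∈ M.evalFrom M.start u ∧
      ∃ f ∈ M.accept, f ∈ M.evalFrom {q} v)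
    (hstart : M.start.Subsingleton)
    (hdet : ∀ (q : σ) (a : α), (M.step q a).Subsingleton)
    (haccept : M.accept.Subsingleton)
    (hcodet : ∀ (q : σ) (a : α), {p : σ | q ∈ M.step p a}.Subsingleton)
    (σ' : Type) [Fintype σ'] (M' : DFA α σ') (h : M'.accepts = M.accepts) :
    Fintype.card σ ≤ Fintype.card σ' := by
  choose u v hu f hf hv using htrim
  refine Fintype.card_le_of_injective (fun q => M'.eval (u q)) fun p q hpq => ?_
  have hp : u p ++ v p ∈ M'.accepts := by
    rw [h]
    exact (M.append_mem_acceptsFrom).2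
      ⟨f p, hf p, NFA.mem_evalFrom_iff_exists.2 ⟨p, hu p, hv p⟩⟩
  have hq : u q ++ v p ∈ M.accepts := by
    rw [← h]
    rw [DFA.mem_accepts, DFA.eval, DFA.evalFrom_of_append] at hp ⊢
    change M'.eval (u p) = M'.eval (u q) at hpq
    simp only [DFA.eval] at hpq
    rwa [← hpq]
  obtain ⟨g, hg, hgq⟩ := (M.append_mem_acceptsFrom).1 hq
  obtain ⟨r, hr, hgr⟩ := NFA.mem_evalFrom_iff_exists.1 hgq
  obtain rfl := NFA.subsingleton_evalFrom hdet hstart (u q) (hu q) hr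
  obtain rfl := haccept (hf p) hg
  exact NFA.eq_of_mem_evalFrom_singleton hcodet (hv p) hgr
end

section
/- Let k be a field, let β ∈ k be nonzero, and let A ⊆ k be a finite nonempty subset. Define the step relation R on k by R(p, q) if and only if there exist g, h ∈ A with q = βp + g − h. Then for every x ∈ k, the following are equivalent: (1) x is reachable from 0 and 0 is reachable from x under the reflexive-transitive closure of R (i.e. x is a state of the trimmed relations automaton); (2) there exist polynomials P and Q, all of whose coefficients lie in A − A := {a − a' : a, a' ∈ A}, such that x = P(β) and x = β⁻¹·Q(β⁻¹). -/
open Pointwise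

open Polynomial in
/-- Horner-style induction on polynomials whose coefficients all lie in a given set. -/
theorem Polynomial.horner_induction_of_coeff_mem {R : Type*} [Semiring R] {D : Set R}
    {motive : R[X] → Prop} (zero : motive 0)
    (step : ∀ P : R[X], ∀ d ∈ D, motive P → motive (P * X + C d))
    (P : R[X]) (hP : ∀ n, P.coeff n ∈ D) : motive P := by
  by_cases h : P = 0
  · exact h ▸ zero
  · rw [← P.divX_mul_X_add]
    exact step _ _ (hP 0) (horner_induction_of_coeff_mem zero step P.divX fun n => by
      simpa only [coeff_divX] using hP (n + 1))
termination_by P.degree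
decreasing_by exact degree_divX_lt h

open Polynomial in
theorem Polynomial.coeff_mul_X_add_C_mem {R : Type*} [Semiring R] {D : Set R} {P : R[X]}
    (hP : ∀ n, P.coeff n ∈ D) {d : R} (hd : d ∈ D) (n : ℕ) :
    (P * X + C d).coeff n ∈ D := by
  cases n with
  | zero => simpa using hd
  | succ n => simpa [coeff_C_succ] using hP n

open Polynomial in
theorem reflTransGen_zero_left_iff {R : Type*} [CommSemiring R] (b : R) {D : Set R}
    (h0 : 0 ∈ D) (x : R) :
    Relation.ReflTransGen (fun p q : R => ∃ d ∈ D, q = b * p + d) 0 x ↔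
      ∃ P : R[X], (∀ n, P.coeff n ∈ D) ∧ x = P.eval b := by
  constructor
  · intro h
    induction h with
    | refl => exact ⟨0, by simpa using h0, by simp⟩
    | tail _ hstep ih =>
      obtain ⟨P, hP, rfl⟩ := ih
      obtain ⟨d, hd, rfl⟩ := hstep
      exact ⟨P * X + C d, coeff_mul_X_add_C_mem hP hd, by simp [mul_comm]⟩
  · rintro ⟨P, hP, rfl⟩
    refine horner_induction_of_coeff_mem (motive := fun P => Relation.ReflTransGen _ 0 (P.eval b))
      ?_ (fun P d hd ih => ih.tail ⟨d, hd, by simp [mul_comm]⟩) P hP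
    simpa using Relation.ReflTransGen.refl

open Polynomial in
theorem reflTransGen_zero_right_iff {k : Type*} [Field k] {b : k} (hb : b ≠ 0) {D : Set k}
    (h0 : 0 ∈ D) (hneg : ∀ d ∈ D, -d ∈ D) (x : k) :
    Relation.ReflTransGen (fun p q : k => ∃ d ∈ D, q = b * p + d) x 0 ↔
      ∃ Q : k[X], (∀ n, Q.coeff n ∈ D) ∧ x = b⁻¹ * Q.eval b⁻¹ := by
  constructor
  · intro h
    induction h using Relation.ReflTransGen.head_induction_on with
    | refl => exact ⟨0, by simpa using h0, by simp⟩
    | @head p q hstep _ ih =>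
      obtain ⟨Q, hQ, hq⟩ := ih
      obtain ⟨d, hd, rfl⟩ := hstep
      refine ⟨Q * X + C (-d), coeff_mul_X_add_C_mem hQ (hneg d hd), ?_⟩
      rw [eval_add, eval_mul_X, eval_C, mul_comm (Q.eval b⁻¹), ← hq]
      field_simp
      ring
  · rintro ⟨Q, hQ, rfl⟩
    refine horner_induction_of_coeff_mem
      (motive := fun Q => Relation.ReflTransGen _ (b⁻¹ * Q.eval b⁻¹) 0) ?_ (fun Q d hd ih => ?_) Q hQ
    · simpa using Relation.ReflTransGen.refl
    · refine ih.head ⟨-d, hneg d hd, ?_⟩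
      rw [eval_add, eval_mul_X, eval_C, mul_inv_cancel_left₀ hb]
      ring

/-- For a field `k`, nonzero `β ∈ k` and a finite nonempty digit set `A ⊆ k`, consider
the step relation `R p q ↔ ∃ g h ∈ A, q = βp + g - h` of the relations automaton. An
element `x ∈ k` is a state of the trimmed automaton (reachable from `0` and with `0`
reachable from it) iff there are polynomials `P, Q` with all coefficients in `A - A`
such that `x = P(β)` and `x = β⁻¹ · Q(β⁻¹)`. -/
theorem trimmed_state_iff_polynomials {k : Type*} [Field k] (β : k) (hβ : β ≠ 0)
    (A : Finset k) (hA : A.Nonempty) (x : k) :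
    (Relation.ReflTransGen (fun p q : k => ∃ g ∈ A, ∃ h ∈ A, q = β * p + g - h) 0 x ∧
     Relation.ReflTransGen (fun p q : k => ∃ g ∈ A, ∃ h ∈ A, q = β * p + g - h) x 0) ↔
    (∃ P Q : Polynomial k,
      (∀ n, P.coeff n ∈ (A : Set k) - (A : Set k)) ∧
      (∀ n, Q.coeff n ∈ (A : Set k) - (A : Set k)) ∧
      x = P.eval β ∧ x = β⁻¹ * Q.eval β⁻¹) := by
  have hR : (fun p q : k => ∃ g ∈ A, ∃ h ∈ A, q = β * p + g - h) =
      fun p q => ∃ d ∈ (A : Set k) - (A : Set k), q = β * p + d := by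
    ext p q
    simp [Set.mem_sub, add_sub_assoc]
  obtain ⟨a, ha⟩ := hA
  have h0 : (0 : k) ∈ (A : Set k) - (A : Set k) := ⟨a, ha, a, ha, sub_self a⟩
  have hneg : ∀ d ∈ (A : Set k) - (A : Set k), -d ∈ (A : Set k) - (A : Set k) := by
    rintro _ ⟨g, hg, h, hh, rfl⟩
    exact ⟨h, hh, g, hg, (neg_sub g h).symm⟩
  rw [hR, reflTransGen_zero_left_iff β h0, reflTransGen_zero_right_iff hβ h0 hneg]
  constructor
  · rintro ⟨⟨P, hP, hxP⟩, Q, hQ, hxQ⟩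
    exact ⟨P, Q, hP, hQ, hxP, hxQ⟩
  · rintro ⟨P, Q, hP, hQ, hxP, hxQ⟩
    exact ⟨⟨P, hP, hxP⟩, Q, hQ, hxQ⟩
end

section
/- Consider the three maps g₀, g₁, g₃ : ℝ → ℝ given by g₀(x) = x/3, g₁(x) = x/3 + 1, g₃(x) = x/3 + 3. For every natural number n, the number of distinct functions ℝ → ℝ obtained as a composition h₁ ∘ h₂ ∘ ⋯ ∘ hₙ with each hᵢ ∈ {g₀, g₁, g₃} equals fib(2n + 2), where fib is the Fibonacci sequence defined by fib(0) = 0, fib(1) = 1, fib(m+2) = fib(m+1) + fib(m). -/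
/-- The numbers `∑ i < n, dᵢ 3 ^ i` with digits `dᵢ ∈ {0, 1, 3}`. -/
def digitSums : ℕ → Finset ℕ
  | 0 => {0}
  | n + 1 => (digitSums n).image (3 * ·) ∪ (digitSums n).image (3 * · + 1) ∪
      (digitSums n).image (3 * · + 3)

theorem mem_digitSums_succ {n k : ℕ} :
    k ∈ digitSums (n + 1) ↔
      ∃ m ∈ digitSums n, k = 3 * m ∨ k = 3 * m + 1 ∨ k = 3 * m + 3 := by
  simp only [digitSums, Finset.mem_union, Finset.mem_image]
  grind

theorem card_image_three_mul_add (s : Finset ℕ) (r : ℕ) :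
    (s.image (3 * · + r)).card = s.card :=
  Finset.card_image_of_injective _ fun a b h => by omega

theorem disjoint_image_three_mul_add (s t : Finset ℕ) {q r : ℕ} (h : ¬ q ≡ r [MOD 3]) :
    Disjoint (s.image (3 * · + q)) (t.image (3 * · + r)) := by
  simp only [Finset.disjoint_left, Finset.mem_image, Nat.ModEq] at h ⊢
  rintro _ ⟨a, -, rfl⟩ ⟨b, -, hb⟩
  omega

theorem digitSums_succ_eq (n : ℕ) :
    digitSums (n + 1) =
      (digitSums n ∪ (digitSums n).image (· + 1)).image (3 * · + 0) ∪
        (digitSums n).image (3 * · + 1) := by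
  ext k
  simp only [mem_digitSums_succ, Finset.mem_union, Finset.mem_image]
  grind

theorem digitSums_succ_union_shift_eq (n : ℕ) :
    digitSums (n + 1) ∪ (digitSums (n + 1)).image (· + 1) =
      (digitSums n ∪ (digitSums n).image (· + 1)).image (3 * · + 0) ∪
        (digitSums n ∪ (digitSums n).image (· + 1)).image (3 * · + 1) ∪
          (digitSums n).image (3 * · + 2) := by
  ext k
  simp only [mem_digitSums_succ, Finset.mem_union, Finset.mem_image]
  grind

theorem card_digitSums (n : ℕ) :
    (digitSums n).card = Nat.fib (2 * n + 2) ∧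
      (digitSums n ∪ (digitSums n).image (· + 1)).card = Nat.fib (2 * n + 3) := by
  induction n with
  | zero => decide
  | succ n ih =>
    have h₄ : Nat.fib (2 * n + 4) = Nat.fib (2 * n + 2) + Nat.fib (2 * n + 3) := Nat.fib_add_two
    have h₅ : Nat.fib (2 * n + 5) = Nat.fib (2 * n + 3) + Nat.fib (2 * n + 4) := Nat.fib_add_two
    constructor
    · rw [digitSums_succ_eq, Finset.card_union_of_disjoint
        (disjoint_image_three_mul_add _ _ (by decide)), card_image_three_mul_add,
        card_image_three_mul_add, ih.1, ih.2, show 2 * (n + 1) + 2 = 2 * n + 4 by ring, h₄]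
      ring
    · rw [digitSums_succ_union_shift_eq, Finset.card_union_of_disjoint
        (Finset.disjoint_union_left.2 ⟨disjoint_image_three_mul_add _ _ (by decide),
          disjoint_image_three_mul_add _ _ (by decide)⟩), Finset.card_union_of_disjoint
        (disjoint_image_three_mul_add _ _ (by decide)), card_image_three_mul_add,
        card_image_three_mul_add, card_image_three_mul_add, ih.1, ih.2,
        show 2 * (n + 1) + 3 = 2 * n + 5 by ring, h₅, h₄]
      ring

theorem foldr_comp_append_singleton {α : Type*} (l : List (α → α)) (g : α → α) :
    (l ++ [g]).foldr (· ∘ ·) id = l.foldr (· ∘ ·) id ∘ g := by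
  induction l with
  | nil => rfl
  | cons h l ih => simp only [List.cons_append, List.foldr_cons, ih, Function.comp_assoc]

/-- The affine map `x ↦ (x + 3 k) / 3 ^ n`. -/
noncomputable def scaledShift (n k : ℕ) (x : ℝ) : ℝ := (x + 3 * k) / 3 ^ n

theorem scaledShift_injective (n : ℕ) : Function.Injective (scaledShift n) := by
  intro a b h
  have h₀ := congrFun h 0
  simp only [scaledShift] at h₀
  field_simp at h₀
  simpa using h₀

theorem scaledShift_comp (n k d : ℕ) :
    scaledShift n k ∘ (fun x => x / 3 + d) = scaledShift (n + 1) (3 * k + d) := by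
  funext x
  simp only [scaledShift, Function.comp_apply, pow_succ]
  push_cast
  field_simp
  ring

theorem mem_generators_iff {g : ℝ → ℝ} :
    g ∈ ({fun x => x / 3, fun x => x / 3 + 1, fun x => x / 3 + 3} : Set (ℝ → ℝ)) ↔
      ∃ d : ℕ, (d = 0 ∨ d = 1 ∨ d = 3) ∧ g = fun x => x / 3 + (d : ℝ) := by
  simp [or_and_right, exists_or]

theorem compositions_eq_image (n : ℕ) :
    { f : ℝ → ℝ | ∃ l : List (ℝ → ℝ), l.length = n ∧
        (∀ g ∈ l, g ∈ ({fun x => x / 3, fun x => x / 3 + 1, fun x => x / 3 + 3} :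
          Set (ℝ → ℝ))) ∧
        f = l.foldr (· ∘ ·) id } = scaledShift n '' (digitSums n : Set ℕ) := by
  induction n with
  | zero =>
    ext f
    have h : scaledShift 0 0 = id := by
      funext x
      simp [scaledShift]
    simp +contextual [digitSums, h, List.length_eq_zero_iff]
  | succ n ih =>
    ext f
    rw [Set.ext_iff] at ih
    simp only [Set.mem_ofPred_eq, Set.mem_image, Finset.mem_coe, mem_generators_iff] at ih ⊢
    constructor
    · rintro ⟨l, hl, hg, rfl⟩
      obtain rfl | ⟨l, g, rfl⟩ := l.eq_nil_or_concat'
      · simp at hl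
      obtain ⟨k, hk, hkl⟩ := (ih _).1 ⟨l, by simpa using hl, fun g hgl => hg g (by simp [hgl]), rfl⟩
      obtain ⟨d, hd, rfl⟩ := hg g (by simp)
      refine ⟨3 * k + d, mem_digitSums_succ.2 ⟨k, hk, by omega⟩, ?_⟩
      rw [foldr_comp_append_singleton, ← hkl, scaledShift_comp]
    · rintro ⟨k, hk, rfl⟩
      obtain ⟨m, hm, hkm⟩ := mem_digitSums_succ.1 hk
      obtain ⟨d, hd, rfl⟩ : ∃ d : ℕ, (d = 0 ∨ d = 1 ∨ d = 3) ∧ k = 3 * m + d :=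
        ⟨k - 3 * m, by omega, by omega⟩
      obtain ⟨l, hl, hg, hml⟩ := (ih _).2 ⟨m, hm, rfl⟩
      refine ⟨l ++ [fun x => x / 3 + (d : ℝ)], by simp [hl], fun g hgl => ?_, ?_⟩
      · rcases List.mem_append.1 hgl with h | h
        · exact hg g h
        · exact ⟨d, hd, List.mem_singleton.1 h⟩
      · rw [foldr_comp_append_singleton, ← hml, scaledShift_comp]

/-- The number of distinct functions `ℝ → ℝ` that are compositions of `n` maps taken
from `{x ↦ x/3, x ↦ x/3 + 1, x ↦ x/3 + 3}` is the Fibonacci number `fib (2n + 2)`. -/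
theorem card_compositions_eq_fib (n : ℕ) :
    { f : ℝ → ℝ | ∃ l : List (ℝ → ℝ), l.length = n ∧
        (∀ g ∈ l, g ∈ ({fun x => x / 3, fun x => x / 3 + 1, fun x => x / 3 + 3} :
          Set (ℝ → ℝ))) ∧
        f = l.foldr (· ∘ ·) id }.ncard = Nat.fib (2 * n + 2) := by
  rw [compositions_eq_image, Set.ncard_image_of_injective _ (scaledShift_injective n),
    Set.ncard_coe_finset, (card_digitSums n).1]
end
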